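/- arXiv:2206.12499 — 6 statements merged into one kernel-verified Lean document; each statement's English description precedes it below -/
import Mathlib

section
/- Let k, ℓ ≥ 2 and let σ = σ₁⋯σₙ be a (k,ℓ)-crucial permutation of length n. Then there exist indices 1 ≤ a₁ < a₂ < ⋯ < a_{k−1} = n with σ_{a₁} < σ_{a₂} < ⋯ < σ_{a_{k−1}} (an occurrence of i_{k−1} ending at σₙ) and indices 1 ≤ b₁ < b₂ < ⋯ < b_{ℓ−1} = n with σ_{b₁} > σ_{b₂} > ⋯ > σ_{b_{ℓ−1}} (an occurrence of d_{ℓ−1} ending at σₙ), such that {a₁,…,a_{k−1}} ∩ {b₁,…,b_{ℓ−1}} = {n}. -/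
/-- `σ` (in one-line notation, 0-based) has an increasing subsequence of length `k`,
i.e. contains an occurrence of the pattern `i_k`. -/
def HasIncr (k n : ℕ) (σ : Fin n → Fin n) : Prop :=
  ∃ f : Fin k → Fin n, StrictMono f ∧ StrictMono (σ ∘ f)

/-- `σ` has a decreasing subsequence of length `l`,
i.e. contains an occurrence of the pattern `d_l`. -/
def HasDecr (l n : ℕ) (σ : Fin n → Fin n) : Prop :=
  ∃ f : Fin l → Fin n, StrictMono f ∧ StrictAnti (σ ∘ f)

/-- `σ` contains `i_k` or `d_l`. -/
def ContainsPat (k l n : ℕ) (σ : Fin n → Fin n) : Prop :=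
  HasIncr k n σ ∨ HasDecr l n σ

/-- `σ` avoids both `i_k` and `d_l`. -/
def AvoidsPat (k l n : ℕ) (σ : Fin n → Fin n) : Prop :=
  ¬ HasIncr k n σ ∧ ¬ HasDecr l n σ

/-- The `i`-th extension of `σ` to the right (0-based): append the value `i` at the end,
renaming old values via `Fin.succAbove i` (i.e. `x ↦ x` if `x < i`, `x ↦ x+1` if `x ≥ i`). -/
def rightExt {n : ℕ} (σ : Fin n → Fin n) (i : Fin (n + 1)) : Fin (n + 1) → Fin (n + 1) :=
  Fin.snoc (fun j => i.succAbove (σ j)) i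

/-- The `i`-th extension of `σ` to the left: prepend the value `i`. -/
def leftExt {n : ℕ} (σ : Fin n → Fin n) (i : Fin (n + 1)) : Fin (n + 1) → Fin (n + 1) :=
  Fin.cons i (fun j => i.succAbove (σ j))

/-- The `i`-th extension of `σ` from above: insert the new maximum value at position `i`. -/
def topExt {n : ℕ} (σ : Fin n → Fin n) (i : Fin (n + 1)) : Fin (n + 1) → Fin (n + 1) :=
  i.insertNth (Fin.last n) (fun j => (σ j).castSucc)

/-- The `i`-th extension of `σ` from below: insert the new minimum value at position `i`,
increasing all old values by one. -/
def botExt {n : ℕ} (σ : Fin n → Fin n) (i : Fin (n + 1)) : Fin (n + 1) → Fin (n + 1) :=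
  i.insertNth 0 (fun j => (σ j).succ)

/-- `σ` is `(k,l)`-right-crucial (also called `(k,l)`-crucial): it avoids `i_k` and `d_l`,
but every extension of it to the right contains `i_k` or `d_l`. -/
def RightCrucial (k l n : ℕ) (σ : Fin n → Fin n) : Prop :=
  AvoidsPat k l n σ ∧ ∀ i : Fin (n + 1), ContainsPat k l (n + 1) (rightExt σ i)

/-- `σ` is `(k,l)`-left-crucial. -/
def LeftCrucial (k l n : ℕ) (σ : Fin n → Fin n) : Prop :=
  AvoidsPat k l n σ ∧ ∀ i : Fin (n + 1), ContainsPat k l (n + 1) (leftExt σ i)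

/-- `σ` is `(k,l)`-top-crucial. -/
def TopCrucial (k l n : ℕ) (σ : Fin n → Fin n) : Prop :=
  AvoidsPat k l n σ ∧ ∀ i : Fin (n + 1), ContainsPat k l (n + 1) (topExt σ i)

/-- `σ` is `(k,l)`-bottom-crucial. -/
def BottomCrucial (k l n : ℕ) (σ : Fin n → Fin n) : Prop :=
  AvoidsPat k l n σ ∧ ∀ i : Fin (n + 1), ContainsPat k l (n + 1) (botExt σ i)

/-- `σ` is `(k,l)`-bicrucial: both right-crucial and left-crucial. -/
def Bicrucial (k l n : ℕ) (σ : Fin n → Fin n) : Prop :=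
  RightCrucial k l n σ ∧ LeftCrucial k l n σ

/-- `σ` is `(k,l)`-top-right-crucial: right-crucial and every extension from above
contains `i_k` or `d_l`. -/
def TopRightCrucial (k l n : ℕ) (σ : Fin n → Fin n) : Prop :=
  RightCrucial k l n σ ∧ ∀ i : Fin (n + 1), ContainsPat k l (n + 1) (topExt σ i)

/-- `σ` is `(k,l)`-tricrucial: bicrucial and every extension from above
contains `i_k` or `d_l`. -/
def Tricrucial (k l n : ℕ) (σ : Fin n → Fin n) : Prop :=
  Bicrucial k l n σ ∧ ∀ i : Fin (n + 1), ContainsPat k l (n + 1) (topExt σ i)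

/-- `σ` is `(k,l)`-quadrocrucial: tricrucial and every extension from below
contains `i_k` or `d_l`. -/
def Quadrocrucial (k l n : ℕ) (σ : Fin n → Fin n) : Prop :=
  Tricrucial k l n σ ∧ ∀ i : Fin (n + 1), ContainsPat k l (n + 1) (botExt σ i)

theorem hasIncr_iff (k n : ℕ) (σ : Fin n → Fin n) :
    HasIncr k n σ ↔ ∃ A : Finset (Fin n), A.card = k ∧ StrictMonoOn σ ↑A := by
  constructor
  · rintro ⟨f, hf, hs⟩
    refine ⟨Finset.univ.image f, by simp [Finset.card_image_of_injective _ hf.injective], ?_⟩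
    intro x hx y hy hxy
    simp only [Finset.coe_image, Finset.coe_univ, Set.image_univ, Set.mem_range] at hx hy
    obtain ⟨a, rfl⟩ := hx
    obtain ⟨b, rfl⟩ := hy
    exact hs (hf.lt_iff_lt.1 hxy)
  · rintro ⟨A, hA, hs⟩
    refine ⟨A.orderEmbOfFin hA, (A.orderEmbOfFin hA).strictMono, ?_⟩
    intro a b hab
    exact hs (A.orderEmbOfFin_mem hA a) (A.orderEmbOfFin_mem hA b)
      ((A.orderEmbOfFin hA).strictMono hab)

theorem hasDecr_iff (k n : ℕ) (σ : Fin n → Fin n) :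
    HasDecr k n σ ↔ ∃ A : Finset (Fin n), A.card = k ∧ StrictAntiOn σ ↑A := by
  constructor
  · rintro ⟨f, hf, hs⟩
    refine ⟨Finset.univ.image f, by simp [Finset.card_image_of_injective _ hf.injective], ?_⟩
    intro x hx y hy hxy
    simp only [Finset.coe_image, Finset.coe_univ, Set.image_univ, Set.mem_range] at hx hy
    obtain ⟨a, rfl⟩ := hx
    obtain ⟨b, rfl⟩ := hy
    exact hs (hf.lt_iff_lt.1 hxy)
  · rintro ⟨A, hA, hs⟩
    refine ⟨A.orderEmbOfFin hA, (A.orderEmbOfFin hA).strictMono, ?_⟩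
    intro a b hab
    exact hs (A.orderEmbOfFin_mem hA a) (A.orderEmbOfFin_mem hA b)
      ((A.orderEmbOfFin hA).strictMono hab)

theorem rightExt_castSucc {n : ℕ} (σ : Fin n → Fin n) (i : Fin (n + 1)) (a : Fin n) :
    rightExt σ i a.castSucc = i.succAbove (σ a) := by
  simp [rightExt]

theorem rightExt_last {n : ℕ} (σ : Fin n → Fin n) (i : Fin (n + 1)) :
    rightExt σ i (Fin.last n) = i := by
  simp [rightExt]

theorem card_pre {n : ℕ} (S : Finset (Fin (n + 1))) :
    (Finset.univ.filter (fun a : Fin n => a.castSucc ∈ S)).card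
      = (S.erase (Fin.last n)).card := by
  rw [← Finset.card_map Fin.castSuccEmb]
  congr 1
  ext x
  induction x using Fin.lastCases with
  | last => simp [Fin.castSucc_ne_last]
  | cast a => simp [Fin.castSucc_ne_last]

theorem incr_ext (k n : ℕ) (σ : Fin n → Fin n) (i : Fin (n + 1))
    (h0 : ¬ HasIncr k n σ) (h : HasIncr k (n + 1) (rightExt σ i)) :
    ∃ A : Finset (Fin n), A.card = k - 1 ∧ StrictMonoOn σ ↑A ∧
      ∀ a ∈ A, (σ a).castSucc < i := by
  rw [hasIncr_iff] at h0 h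
  obtain ⟨S, hS, hm⟩ := h
  have hc := card_pre S
  have hmono : StrictMonoOn σ
      ↑(Finset.univ.filter (fun a : Fin n => a.castSucc ∈ S)) := by
    intro a ha b hb hab
    simp only [Finset.coe_filter, Finset.mem_univ, true_and, Set.mem_setOf_eq] at ha hb
    have := hm ha hb (Fin.castSucc_lt_castSucc_iff.2 hab)
    rwa [rightExt_castSucc, rightExt_castSucc, Fin.succAbove_lt_succAbove_iff] at this
  by_cases hl : Fin.last n ∈ S
  · refine ⟨_, ?_, hmono, ?_⟩
    · rw [hc, Finset.card_erase_of_mem hl, hS]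
    · intro a ha
      simp only [Finset.mem_filter, Finset.mem_univ, true_and] at ha
      have := hm ha hl (Fin.castSucc_lt_last a)
      rwa [rightExt_castSucc, rightExt_last, Fin.succAbove_lt_iff_castSucc_lt] at this
  · exact absurd ⟨_, by rw [hc, Finset.erase_eq_of_notMem hl, hS], hmono⟩ h0

theorem decr_ext (k n : ℕ) (σ : Fin n → Fin n) (i : Fin (n + 1))
    (h0 : ¬ HasDecr k n σ) (h : HasDecr k (n + 1) (rightExt σ i)) :
    ∃ A : Finset (Fin n), A.card = k - 1 ∧ StrictAntiOn σ ↑A ∧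
      ∀ a ∈ A, i ≤ (σ a).castSucc := by
  rw [hasDecr_iff] at h0 h
  obtain ⟨S, hS, hm⟩ := h
  have hc := card_pre S
  have hmono : StrictAntiOn σ
      ↑(Finset.univ.filter (fun a : Fin n => a.castSucc ∈ S)) := by
    intro a ha b hb hab
    simp only [Finset.coe_filter, Finset.mem_univ, true_and, Set.mem_setOf_eq] at ha hb
    have := hm ha hb (Fin.castSucc_lt_castSucc_iff.2 hab)
    rwa [rightExt_castSucc, rightExt_castSucc, Fin.succAbove_lt_succAbove_iff] at this
  by_cases hl : Fin.last n ∈ S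
  · refine ⟨_, ?_, hmono, ?_⟩
    · rw [hc, Finset.card_erase_of_mem hl, hS]
    · intro a ha
      simp only [Finset.mem_filter, Finset.mem_univ, true_and] at ha
      have := hm ha hl (Fin.castSucc_lt_last a)
      rwa [rightExt_castSucc, rightExt_last, Fin.lt_succAbove_iff_le_castSucc] at this
  · exact absurd ⟨_, by rw [hc, Finset.erase_eq_of_notMem hl, hS], hmono⟩ h0

theorem incr_append (k m : ℕ) (hk : 2 ≤ k) (σ : Fin (m + 1) → Fin (m + 1))
    (h0 : ¬ HasIncr k (m + 1) σ) (A : Finset (Fin (m + 1))) (hA : A.card = k - 1)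
    (hm : StrictMonoOn σ ↑A) (hlast : Fin.last m ∉ A)
    (hlt : ∀ a ∈ A, σ a < σ (Fin.last m)) : False := by
  apply h0
  rw [hasIncr_iff]
  refine ⟨insert (Fin.last m) A, by rw [Finset.card_insert_of_notMem hlast]; omega, ?_⟩
  intro x hx y hy hxy
  rw [Finset.mem_coe, Finset.mem_insert] at hx hy
  rcases hx with rfl | hx
  · exact absurd hxy (Fin.le_last y).not_gt
  · rcases hy with rfl | hy
    · exact hlt x hx
    · exact hm hx hy hxy

theorem decr_append (k m : ℕ) (hk : 2 ≤ k) (σ : Fin (m + 1) → Fin (m + 1))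
    (h0 : ¬ HasDecr k (m + 1) σ) (A : Finset (Fin (m + 1))) (hA : A.card = k - 1)
    (hm : StrictAntiOn σ ↑A) (hlast : Fin.last m ∉ A)
    (hlt : ∀ a ∈ A, σ (Fin.last m) < σ a) : False := by
  apply h0
  rw [hasDecr_iff]
  refine ⟨insert (Fin.last m) A, by rw [Finset.card_insert_of_notMem hlast]; omega, ?_⟩
  intro x hx y hy hxy
  rw [Finset.mem_coe, Finset.mem_insert] at hx hy
  rcases hx with rfl | hx
  · exact absurd hxy (Fin.le_last y).not_gt
  · rcases hy with rfl | hy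
    · exact hlt x hx
    · exact hm hx hy hxy

/-- Lemma 1 of the paper: a `(k,l)`-crucial permutation has an occurrence of
`i_{k-1}` and an occurrence of `d_{l-1}`, both ending at the last position, sharing only
the last position. (Occurrences are recorded as the sets of their positions.) -/
theorem crucial_has_incr_decr_ending_at_last (k l n : ℕ) (hk : 2 ≤ k) (hl : 2 ≤ l)
    (σ : Fin n → Fin n) (hσ : Function.Bijective σ)
    (hc : RightCrucial k l n σ) :
    ∃ hn : 0 < n, ∃ A B : Finset (Fin n),
      A.card = k - 1 ∧ B.card = l - 1 ∧
      StrictMonoOn σ ↑A ∧ StrictAntiOn σ ↑B ∧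
      (⟨n - 1, by omega⟩ : Fin n) ∈ A ∧ (⟨n - 1, by omega⟩ : Fin n) ∈ B ∧
      A ∩ B = {(⟨n - 1, by omega⟩ : Fin n)} := by
  obtain ⟨⟨hi, hd⟩, hext⟩ := hc
  rcases n with _ | m
  · exfalso
    rcases hext 0 with ⟨f, hf, -⟩ | ⟨f, hf, -⟩
    · have := Fintype.card_le_of_injective f hf.injective
      simp at this; omega
    · have := Fintype.card_le_of_injective f hf.injective
      simp at this; omega
  refine ⟨Nat.succ_pos m, ?_⟩
  change ∃ A B : Finset (Fin (m + 1)), A.card = k - 1 ∧ B.card = l - 1 ∧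
      StrictMonoOn σ ↑A ∧ StrictAntiOn σ ↑B ∧
      Fin.last m ∈ A ∧ Fin.last m ∈ B ∧ A ∩ B = {Fin.last m}
  obtain ⟨A, hA, hAm, hAl⟩ : ∃ A : Finset (Fin (m + 1)), A.card = k - 1 ∧ StrictMonoOn σ ↑A ∧
      ∀ a ∈ A, σ a ≤ σ (Fin.last m) := by
    rcases hext (σ (Fin.last m)).succ with h | h
    · obtain ⟨A, h1, h2, h3⟩ := incr_ext _ _ _ _ hi h
      exact ⟨A, h1, h2, fun a ha => Fin.castSucc_lt_succ_iff.1 (h3 a ha)⟩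
    · obtain ⟨A, h1, h2, h3⟩ := decr_ext _ _ _ _ hd h
      have h4 : ∀ a ∈ A, σ (Fin.last m) < σ a :=
        fun a ha => Fin.succ_le_castSucc_iff.1 (h3 a ha)
      exact (decr_append l m hl σ hd A h1 h2 (fun h => lt_irrefl _ (h4 _ h)) h4).elim
  obtain ⟨B, hB, hBm, hBl⟩ : ∃ A : Finset (Fin (m + 1)), A.card = l - 1 ∧ StrictAntiOn σ ↑A ∧
      ∀ a ∈ A, σ (Fin.last m) ≤ σ a := by
    rcases hext (σ (Fin.last m)).castSucc with h | h
    · obtain ⟨A, h1, h2, h3⟩ := incr_ext _ _ _ _ hi h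
      have h4 : ∀ a ∈ A, σ a < σ (Fin.last m) :=
        fun a ha => Fin.castSucc_lt_castSucc_iff.1 (h3 a ha)
      exact (incr_append k m hk σ hi A h1 h2 (fun h => lt_irrefl _ (h4 _ h)) h4).elim
    · obtain ⟨A, h1, h2, h3⟩ := decr_ext _ _ _ _ hd h
      exact ⟨A, h1, h2, fun a ha => Fin.castSucc_le_castSucc_iff.1 (h3 a ha)⟩
  have hlA : Fin.last m ∈ A := by
    by_contra hn
    exact incr_append k m hk σ hi A hA hAm hn fun a ha =>
      lt_of_le_of_ne (hAl a ha) fun e => hn (hσ.1 e ▸ ha)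
  have hlB : Fin.last m ∈ B := by
    by_contra hn
    exact decr_append l m hl σ hd B hB hBm hn fun a ha =>
      lt_of_le_of_ne (hBl a ha) fun e => hn (hσ.1 e ▸ ha)
  refine ⟨A, B, hA, hB, hAm, hBm, hlA, hlB, ?_⟩
  ext x
  rw [Finset.mem_inter, Finset.mem_singleton]
  constructor
  · rintro ⟨h1, h2⟩
    exact hσ.1 (le_antisymm (hAl x h1) (hBl x h2))
  · rintro rfl
    exact ⟨hlA, hlB⟩
end

section
/- Let k, ℓ ≥ 2 and let σ = σ₁⋯σₙ be a (k,ℓ)-left-crucial permutation of length n. Then there exist indices 1 = a₁ < a₂ < ⋯ < a_{k−1} ≤ n with σ_{a₁} < σ_{a₂} < ⋯ < σ_{a_{k−1}} (an occurrence of i_{k−1} beginning at σ₁) and indices 1 = b₁ < b₂ < ⋯ < b_{ℓ−1} ≤ n with σ_{b₁} > σ_{b₂} > ⋯ > σ_{b_{ℓ−1}} (an occurrence of d_{ℓ−1} beginning at σ₁), such that {a₁,…,a_{k−1}} ∩ {b₁,…,b_{ℓ−1}} = {1}. -/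
theorem aux_incr {k n : ℕ} {σ : Fin n → Fin n} {i : Fin (n+1)} (h0 : ¬ HasIncr (k+1) n σ)
    (h : HasIncr (k+1) (n+1) (leftExt σ i)) :
    ∃ A : Finset (Fin n), A.card = k ∧ StrictMonoOn σ ↑A ∧ ∀ a ∈ A, i ≤ (σ a).castSucc := by
  obtain ⟨f, hf, hs⟩ := h
  by_cases hz : f 0 = 0
  · have hne : ∀ j : Fin k, ∃ g : Fin n, f j.succ = g.succ := fun j => by
      have : f 0 < f j.succ := hf (Fin.succ_pos j)
      exact ⟨(f j.succ).pred (by rintro e; rw [e] at this; exact absurd this (Fin.not_lt_zero _)), by simp⟩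
    choose g hg using hne
    have hgm : StrictMono g := fun a b hab => by
      have := hf (Fin.succ_lt_succ_iff.2 hab)
      rw [hg, hg] at this
      exact Fin.succ_lt_succ_iff.1 this
    refine ⟨Finset.univ.map ⟨g, hgm.injective⟩, by simp, ?_, ?_⟩
    · intro x hx y hy hxy
      simp at hx hy
      obtain ⟨a, rfl⟩ := hx
      obtain ⟨b, rfl⟩ := hy
      have := hs (Fin.succ_lt_succ_iff.2 (hgm.lt_iff_lt.1 hxy))
      simp only [Function.comp, hg, leftExt, Fin.cons_succ] at this
      exact (Fin.strictMono_succAbove i).lt_iff_lt.1 this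
    · intro x hx
      simp at hx
      obtain ⟨a, rfl⟩ := hx
      have := hs (Fin.succ_pos a)
      simp only [Function.comp, hg, hz, leftExt, Fin.cons_succ, Fin.cons_zero] at this
      exact (Fin.lt_succAbove_iff_le_castSucc i _).1 this
  · exfalso
    have hne : ∀ j, ∃ g : Fin n, f j = g.succ := fun j => by
      have h1 : f 0 ≤ f j := hf.monotone (Fin.zero_le j)
      exact ⟨(f j).pred (by rintro e; rw [e] at h1; exact hz (Fin.le_zero_iff.1 h1)), by simp⟩
    choose g hg using hne
    refine h0 ⟨g, fun a b hab => ?_, fun a b hab => ?_⟩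
    · have := hf hab
      rw [hg, hg] at this
      exact Fin.succ_lt_succ_iff.1 this
    · have := hs hab
      simp only [Function.comp, hg, leftExt, Fin.cons_succ] at this
      exact (Fin.strictMono_succAbove i).lt_iff_lt.1 this

theorem aux_decr {k n : ℕ} {σ : Fin n → Fin n} {i : Fin (n+1)} (h0 : ¬ HasDecr (k+1) n σ)
    (h : HasDecr (k+1) (n+1) (leftExt σ i)) :
    ∃ A : Finset (Fin n), A.card = k ∧ StrictAntiOn σ ↑A ∧ ∀ a ∈ A, (σ a).castSucc < i := by
  obtain ⟨f, hf, hs⟩ := h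
  by_cases hz : f 0 = 0
  · have hne : ∀ j : Fin k, ∃ g : Fin n, f j.succ = g.succ := fun j => by
      have : f 0 < f j.succ := hf (Fin.succ_pos j)
      exact ⟨(f j.succ).pred (by rintro e; rw [e] at this; exact absurd this (Fin.not_lt_zero _)), by simp⟩
    choose g hg using hne
    have hgm : StrictMono g := fun a b hab => by
      have := hf (Fin.succ_lt_succ_iff.2 hab)
      rw [hg, hg] at this
      exact Fin.succ_lt_succ_iff.1 this
    refine ⟨Finset.univ.map ⟨g, hgm.injective⟩, by simp, ?_, ?_⟩
    · intro x hx y hy hxy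
      simp at hx hy
      obtain ⟨a, rfl⟩ := hx
      obtain ⟨b, rfl⟩ := hy
      have := hs (Fin.succ_lt_succ_iff.2 (hgm.lt_iff_lt.1 hxy))
      simp only [Function.comp, hg, leftExt, Fin.cons_succ] at this
      exact (Fin.strictMono_succAbove i).lt_iff_lt.1 this
    · intro x hx
      simp at hx
      obtain ⟨a, rfl⟩ := hx
      have := hs (Fin.succ_pos a)
      simp only [Function.comp, hg, hz, leftExt, Fin.cons_succ, Fin.cons_zero] at this
      exact (Fin.succAbove_lt_iff_castSucc_lt i _).1 this
  · exfalso
    have hne : ∀ j, ∃ g : Fin n, f j = g.succ := fun j => by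
      have h1 : f 0 ≤ f j := hf.monotone (Fin.zero_le j)
      exact ⟨(f j).pred (by rintro e; rw [e] at h1; exact hz (Fin.le_zero_iff.1 h1)), by simp⟩
    choose g hg using hne
    refine h0 ⟨g, fun a b hab => ?_, fun a b hab => ?_⟩
    · have := hf hab
      rw [hg, hg] at this
      exact Fin.succ_lt_succ_iff.1 this
    · have := hs hab
      simp only [Function.comp, hg, leftExt, Fin.cons_succ] at this
      exact (Fin.strictMono_succAbove i).lt_iff_lt.1 this

theorem aux_pre_incr {k n : ℕ} {σ : Fin n → Fin n} (z : Fin n) (hz : ∀ x, z ≤ x)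
    (h0 : ¬ HasIncr (k+1) n σ) (A : Finset (Fin n)) (hA : A.card = k) (hm : StrictMonoOn σ ↑A)
    (hzA : z ∉ A) (hlt : ∀ a ∈ A, σ z < σ a) : False := by
  have hc : (insert z A).card = k + 1 := by rw [Finset.card_insert_of_notMem hzA, hA]
  refine h0 ⟨(insert z A).orderEmbOfFin hc, OrderEmbedding.strictMono _, fun a b hab => ?_⟩
  have ha := Finset.orderEmbOfFin_mem (insert z A) hc a
  have hb := Finset.orderEmbOfFin_mem (insert z A) hc b
  have hab' := (OrderEmbedding.strictMono ((insert z A).orderEmbOfFin hc)) hab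
  simp only [Function.comp]
  generalize (insert z A).orderEmbOfFin hc a = x at *
  generalize (insert z A).orderEmbOfFin hc b = y at *
  rcases Finset.mem_insert.1 hb with rfl | hb2
  · exact absurd hab' (not_lt.2 (hz x))
  · rcases Finset.mem_insert.1 ha with rfl | ha2
    · exact hlt _ hb2
    · exact hm ha2 hb2 hab'

theorem aux_pre_decr {k n : ℕ} {σ : Fin n → Fin n} (z : Fin n) (hz : ∀ x, z ≤ x)
    (h0 : ¬ HasDecr (k+1) n σ) (A : Finset (Fin n)) (hA : A.card = k) (hm : StrictAntiOn σ ↑A)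
    (hzA : z ∉ A) (hlt : ∀ a ∈ A, σ a < σ z) : False := by
  have hc : (insert z A).card = k + 1 := by rw [Finset.card_insert_of_notMem hzA, hA]
  refine h0 ⟨(insert z A).orderEmbOfFin hc, OrderEmbedding.strictMono _, fun a b hab => ?_⟩
  have ha := Finset.orderEmbOfFin_mem (insert z A) hc a
  have hb := Finset.orderEmbOfFin_mem (insert z A) hc b
  have hab' := (OrderEmbedding.strictMono ((insert z A).orderEmbOfFin hc)) hab
  simp only [Function.comp]
  generalize (insert z A).orderEmbOfFin hc a = x at *
  generalize (insert z A).orderEmbOfFin hc b = y at *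
  rcases Finset.mem_insert.1 hb with rfl | hb2
  · exact absurd hab' (not_lt.2 (hz x))
  · rcases Finset.mem_insert.1 ha with rfl | ha2
    · exact hlt _ hb2
    · exact hm ha2 hb2 hab'

/-- Lemma 2 of the paper: a `(k,l)`-left-crucial permutation has an occurrence of
`i_{k-1}` and an occurrence of `d_{l-1}`, both beginning at the first position, sharing only
the first position. -/
theorem leftCrucial_has_incr_decr_beginning_at_first (k l n : ℕ) (hk : 2 ≤ k) (hl : 2 ≤ l)
    (σ : Fin n → Fin n) (hσ : Function.Bijective σ)
    (hc : LeftCrucial k l n σ) :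
    ∃ hn : 0 < n, ∃ A B : Finset (Fin n),
      A.card = k - 1 ∧ B.card = l - 1 ∧
      StrictMonoOn σ ↑A ∧ StrictAntiOn σ ↑B ∧
      (⟨0, hn⟩ : Fin n) ∈ A ∧ (⟨0, hn⟩ : Fin n) ∈ B ∧
      A ∩ B = {(⟨0, hn⟩ : Fin n)} := by
  obtain ⟨k, rfl⟩ : ∃ m, k = m + 1 := ⟨k - 1, by omega⟩
  obtain ⟨l, rfl⟩ : ∃ m, l = m + 1 := ⟨l - 1, by omega⟩
  obtain ⟨⟨hi, hd⟩, hc⟩ := hc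
  have key : ∀ i, (∃ A : Finset (Fin n), A.card = k ∧ StrictMonoOn σ ↑A ∧
      ∀ a ∈ A, i ≤ (σ a).castSucc) ∨ (∃ A : Finset (Fin n), A.card = l ∧ StrictAntiOn σ ↑A ∧
      ∀ a ∈ A, (σ a).castSucc < i) := fun i =>
    (hc i).imp (aux_incr hi) (aux_decr hd)
  have hn : 0 < n := by
    rcases Nat.eq_zero_or_pos n with rfl | h
    · rcases key 0 with ⟨A, hA, -⟩ | ⟨A, hA, -⟩ <;>
      · rw [Finset.eq_empty_of_isEmpty A] at hA
        simp at hA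
        omega
    · exact h
  refine ⟨hn, ?_⟩
  generalize hzz : (⟨0, hn⟩ : Fin n) = z
  have hz : ∀ x, z ≤ x := fun x => by subst hzz; exact Nat.zero_le _
  have hA : ∃ A : Finset (Fin n), A.card = k ∧ StrictMonoOn σ ↑A ∧ z ∈ A ∧
      ∀ a ∈ A, σ z ≤ σ a := by
    rcases key (σ z).castSucc with ⟨A, h1, h2, h3⟩ | ⟨A, h1, h2, h3⟩
    · have h4 : ∀ a ∈ A, σ z ≤ σ a := fun a ha => by simpa using h3 a ha
      refine ⟨A, h1, h2, ?_, h4⟩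
      by_contra hzA
      exact aux_pre_incr z hz hi A h1 h2 hzA fun a ha => lt_of_le_of_ne (h4 a ha)
        fun e => hzA (hσ.1 e ▸ ha)
    · have h4 : ∀ a ∈ A, σ a < σ z := fun a ha => by simpa using h3 a ha
      exact (aux_pre_decr z hz hd A h1 h2 (fun h => lt_irrefl _ (h4 z h)) h4).elim
  have hB : ∃ A : Finset (Fin n), A.card = l ∧ StrictAntiOn σ ↑A ∧ z ∈ A ∧
      ∀ a ∈ A, σ a ≤ σ z := by
    rcases key (σ z).succ with ⟨A, h1, h2, h3⟩ | ⟨A, h1, h2, h3⟩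
    · have h4 : ∀ a ∈ A, σ z < σ a := fun a ha => by
        exact Fin.succ_le_castSucc_iff.1 (h3 a ha)
      exact (aux_pre_incr z hz hi A h1 h2 (fun h => lt_irrefl _ (h4 z h)) h4).elim
    · have h4 : ∀ a ∈ A, σ a ≤ σ z := fun a ha => by
        exact Fin.castSucc_lt_succ_iff.1 (h3 a ha)
      refine ⟨A, h1, h2, ?_, h4⟩
      by_contra hzA
      exact aux_pre_decr z hz hd A h1 h2 hzA fun a ha => lt_of_le_of_ne (h4 a ha)
        fun e => hzA (hσ.1 e ▸ ha)
  obtain ⟨A, a1, a2, a3, a4⟩ := hA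
  obtain ⟨B, b1, b2, b3, b4⟩ := hB
  refine ⟨A, B, by simpa using a1, by simpa using b1, a2, b2, a3, b3, ?_⟩
  ext x
  simp only [Finset.mem_inter, Finset.mem_singleton]
  constructor
  · rintro ⟨hxa, hxb⟩
    exact hσ.1 (le_antisymm (b4 x hxb) (a4 x hxa))
  · rintro rfl
    exact ⟨a3, b3⟩
end

section
/- Let k, ℓ ≥ 2. Every (k,ℓ)-crucial permutation has length at least k+ℓ−3. Moreover, every (k,ℓ)-crucial permutation σ = σ₁⋯σₙ of length n = k+ℓ−3 has the following form: σₙ = k−1; the elements 1, 2, …, k−2 occupy positions among 1,…,n−1 and appear in increasing order (forming an occurrence of i_{k−2}); and the elements k, k+1, …, k+ℓ−3 occupy the remaining positions among 1,…,n−1 and appear in decreasing order (forming an occurrence of d_{ℓ−2}). -/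
theorem ext_incr {a n : ℕ} (σ : Fin n → Fin n) (i : Fin (n+1)) (h0 : ¬ HasIncr (a+1) n σ)
    (h : HasIncr (a+1) (n+1) (rightExt σ i)) :
    ∃ A : Finset (Fin n), A.card = a ∧ (∀ x ∈ A, (σ x : ℕ) < i) ∧
      ∀ x ∈ A, ∀ y ∈ A, x < y → σ x < σ y := by
  obtain ⟨f, hf, hg⟩ := h
  have key : ∀ j, f j ≠ Fin.last n → ∃ y : Fin n, f j = y.castSucc := fun j hj =>
    ⟨(f j).castPred hj, by simp⟩
  by_cases hlast : f (Fin.last a) = Fin.last n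
  · have h1 : ∀ j : Fin a, ∃ y : Fin n, f j.castSucc = y.castSucc := by
      intro j
      apply key
      have := hf (Fin.castSucc_lt_last j)
      rw [hlast] at this
      exact this.ne
    choose g hg1 using h1
    have gm : StrictMono g := by
      intro x y hxy
      have := hf (Fin.castSucc_lt_castSucc_iff.2 hxy)
      rwa [hg1, hg1, Fin.castSucc_lt_castSucc_iff] at this
    refine ⟨Finset.univ.image g, ?_, ?_, ?_⟩
    · rw [Finset.card_image_of_injective _ gm.injective]; simp
    · intro x hx
      obtain ⟨j, -, rfl⟩ := Finset.mem_image.1 hx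
      have := hg (Fin.castSucc_lt_last j)
      simp only [Function.comp, hlast, hg1, rightExt, Fin.snoc_castSucc, Fin.snoc_last] at this
      rw [Fin.succAbove_lt_iff_castSucc_lt] at this
      exact this
    · intro x hx y hy hxy
      obtain ⟨j, -, rfl⟩ := Finset.mem_image.1 hx
      obtain ⟨j', -, rfl⟩ := Finset.mem_image.1 hy
      have := hg (Fin.castSucc_lt_castSucc_iff.2 (gm.lt_iff_lt.1 hxy))
      simp only [Function.comp, hg1, rightExt, Fin.snoc_castSucc] at this
      exact (Fin.strictMono_succAbove i).lt_iff_lt.1 this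
  · exfalso
    have h1 : ∀ j : Fin (a+1), ∃ y : Fin n, f j = y.castSucc := by
      intro j
      apply key
      have := hf.monotone (Fin.le_last j)
      exact (lt_of_le_of_lt this (Fin.lt_last_iff_ne_last.2 hlast)).ne
    choose g hg1 using h1
    refine h0 ⟨g, ?_, ?_⟩
    · intro x y hxy
      have := hf hxy
      rwa [hg1, hg1, Fin.castSucc_lt_castSucc_iff] at this
    · intro x y hxy
      have := hg hxy
      simp only [Function.comp, hg1, rightExt, Fin.snoc_castSucc] at this
      exact (Fin.strictMono_succAbove i).lt_iff_lt.1 this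

theorem ext_decr {a n : ℕ} (σ : Fin n → Fin n) (i : Fin (n+1)) (h0 : ¬ HasDecr (a+1) n σ)
    (h : HasDecr (a+1) (n+1) (rightExt σ i)) :
    ∃ A : Finset (Fin n), A.card = a ∧ (∀ x ∈ A, (i : ℕ) ≤ σ x) ∧
      ∀ x ∈ A, ∀ y ∈ A, x < y → σ y < σ x := by
  obtain ⟨f, hf, hg⟩ := h
  have key : ∀ j, f j ≠ Fin.last n → ∃ y : Fin n, f j = y.castSucc := fun j hj =>
    ⟨(f j).castPred hj, by simp⟩
  by_cases hlast : f (Fin.last a) = Fin.last n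
  · have h1 : ∀ j : Fin a, ∃ y : Fin n, f j.castSucc = y.castSucc := by
      intro j
      apply key
      have := hf (Fin.castSucc_lt_last j)
      rw [hlast] at this
      exact this.ne
    choose g hg1 using h1
    have gm : StrictMono g := by
      intro x y hxy
      have := hf (Fin.castSucc_lt_castSucc_iff.2 hxy)
      rwa [hg1, hg1, Fin.castSucc_lt_castSucc_iff] at this
    refine ⟨Finset.univ.image g, ?_, ?_, ?_⟩
    · rw [Finset.card_image_of_injective _ gm.injective]; simp
    · intro x hx
      obtain ⟨j, -, rfl⟩ := Finset.mem_image.1 hx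
      have := hg (Fin.castSucc_lt_last j)
      simp only [Function.comp, hlast, hg1, rightExt, Fin.snoc_castSucc, Fin.snoc_last] at this
      rw [Fin.lt_succAbove_iff_le_castSucc] at this
      exact this
    · intro x hx y hy hxy
      obtain ⟨j, -, rfl⟩ := Finset.mem_image.1 hx
      obtain ⟨j', -, rfl⟩ := Finset.mem_image.1 hy
      have := hg (Fin.castSucc_lt_castSucc_iff.2 (gm.lt_iff_lt.1 hxy))
      simp only [Function.comp, hg1, rightExt, Fin.snoc_castSucc] at this
      exact (Fin.strictMono_succAbove i).lt_iff_lt.1 this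
  · exfalso
    have h1 : ∀ j : Fin (a+1), ∃ y : Fin n, f j = y.castSucc := by
      intro j
      apply key
      have := hf.monotone (Fin.le_last j)
      exact (lt_of_le_of_lt this (Fin.lt_last_iff_ne_last.2 hlast)).ne
    choose g hg1 using h1
    refine h0 ⟨g, ?_, ?_⟩
    · intro x y hxy
      have := hf hxy
      rwa [hg1, hg1, Fin.castSucc_lt_castSucc_iff] at this
    · intro x y hxy
      have := hg hxy
      simp only [Function.comp, hg1, rightExt, Fin.snoc_castSucc] at this
      exact (Fin.strictMono_succAbove i).lt_iff_lt.1 this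

theorem crucial_core {a b n : ℕ} (ha : 1 ≤ a) (hb : 1 ≤ b) (σ : Fin n → Fin n)
    (h : RightCrucial (a+1) (b+1) n σ) :
    ∃ (v : ℕ) (A B : Finset (Fin n)), v < n ∧ A.card = a ∧ B.card = b ∧
      (∀ x ∈ A, (σ x : ℕ) ≤ v) ∧ (∀ x ∈ B, v ≤ (σ x : ℕ)) ∧
      (∀ x ∈ A, ∀ y ∈ A, x < y → σ x < σ y) ∧
      (∀ x ∈ B, ∀ y ∈ B, x < y → σ y < σ x) := by
  classical
  obtain ⟨⟨h1, h2⟩, h3⟩ := h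
  let P : ℕ → Prop := fun i => ∃ A : Finset (Fin n), A.card = a ∧ (∀ x ∈ A, (σ x : ℕ) < i) ∧
      ∀ x ∈ A, ∀ y ∈ A, x < y → σ x < σ y
  have hQ : ∀ i ≤ n, ¬ P i → ∃ A : Finset (Fin n), A.card = b ∧ (∀ x ∈ A, i ≤ (σ x : ℕ)) ∧
      ∀ x ∈ A, ∀ y ∈ A, x < y → σ y < σ x := by
    intro i hi hP
    rcases h3 ⟨i, by omega⟩ with h | h
    · exact absurd (ext_incr σ _ h1 h) hP
    · exact ext_decr σ _ h2 h
  have hPn : P n := by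
    by_contra hP
    obtain ⟨A, hA, hA2, -⟩ := hQ n le_rfl hP
    obtain ⟨x, hx⟩ := Finset.card_pos.1 (by omega : 0 < A.card)
    have := hA2 x hx
    have := (σ x).2
    omega
  have hex : ∃ i, P i := ⟨n, hPn⟩
  have hm := Nat.find_spec hex
  have hmn : Nat.find hex ≤ n := Nat.find_le hPn
  have hm0 : Nat.find hex ≠ 0 := by
    intro h0
    rw [h0] at hm
    obtain ⟨A, hA, hA2, -⟩ := hm
    obtain ⟨x, hx⟩ := Finset.card_pos.1 (by omega : 0 < A.card)
    have := hA2 x hx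
    omega
  obtain ⟨B, hB, hB2, hB3⟩ := hQ (Nat.find hex - 1) (by omega) (Nat.find_min hex (by omega))
  obtain ⟨A, hA, hA2, hA3⟩ := hm
  refine ⟨Nat.find hex - 1, A, B, by omega, hA, hB, ?_, hB2, hA3, hB3⟩
  intro x hx
  have := hA2 x hx
  omega

theorem inter_card {n : ℕ} (σ : Fin n → Fin n) (hσ : Function.Injective σ) (v : ℕ)
    (A B : Finset (Fin n)) 
      (hA : ∀ x ∈ A, (σ x : ℕ) ≤ v) (hB : ∀ x ∈ B, v ≤ (σ x : ℕ)) : (A ∩ B).card ≤ 1 := by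
  rw [Finset.card_le_one]
  intro x hx y hy
  rw [Finset.mem_inter] at hx hy
  apply hσ
  have := hA x hx.1
  have := hA y hy.1
  have := hB x hx.2
  have := hB y hy.2
  apply Fin.ext
  omega

theorem minimal_aux {a b n : ℕ} (ha : 1 ≤ a) (hb : 1 ≤ b) (hn : n + 1 = a + b)
    (σ : Fin n → Fin n) (hσ : Function.Injective σ)
    (h : RightCrucial (a+1) (b+1) n σ) :
    (∀ q : Fin n, (q : ℕ) = n - 1 → (σ q : ℕ) = a - 1) ∧
      (∀ i j : Fin n, (σ i : ℕ) < a - 1 → (σ j : ℕ) < a - 1 → i < j → σ i < σ j) ∧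
      (∀ i j : Fin n, a ≤ (σ i : ℕ) → a ≤ (σ j : ℕ) → i < j → σ j < σ i) := by
  classical
  obtain ⟨v, A, B, hv, hA, hB, hA2, hB2, hA3, hB3⟩ := crucial_core ha hb σ h
  have hi := inter_card σ hσ v A B hA2 hB2
  have hu := Finset.card_union_add_card_inter A B
  have hun : (A ∪ B).card ≤ n := by simpa using Finset.card_le_univ (A ∪ B)
  have hall : A ∪ B = Finset.univ := by
    rw [← Finset.card_eq_iff_eq_univ, Fintype.card_fin]
    omega
  have hmem : ∀ x, x ∈ A ∨ x ∈ B := fun x => Finset.mem_union.1 (hall ▸ Finset.mem_univ x)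
  obtain ⟨p, hp⟩ := Finset.card_pos.1 (by omega : 0 < (A ∩ B).card)
  obtain ⟨hpA, hpB⟩ := Finset.mem_inter.1 hp
  have hpv : (σ p : ℕ) = v := le_antisymm (hA2 p hpA) (hB2 p hpB)
  have hinj : Function.Injective (fun x => (σ x : ℕ)) := Fin.val_injective.comp hσ
  have c1 : a ≤ v + 1 := by
    have := Finset.card_le_card (s := A.image (fun x => (σ x : ℕ))) (t := Finset.range (v+1))
      (by
        intro y hy
        obtain ⟨x, hx, rfl⟩ := Finset.mem_image.1 hy
        have := hA2 x hx
        exact Finset.mem_range.2 (by omega))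
    rwa [Finset.card_image_of_injective _ hinj, hA, Finset.card_range] at this
  have c2 : b ≤ n - v := by
    have := Finset.card_le_card (s := B.image (fun x => (σ x : ℕ))) (t := Finset.Ico v n)
      (by
        intro y hy
        obtain ⟨x, hx, rfl⟩ := Finset.mem_image.1 hy
        exact Finset.mem_Ico.2 ⟨hB2 x hx, (σ x).2⟩)
    rwa [Finset.card_image_of_injective _ hinj, hB, Nat.card_Ico] at this
  have hva : v = a - 1 := by omega
  refine ⟨?_, ?_, ?_⟩
  · intro q hq
    rcases lt_or_ge p q with hpq | hpq
    · exfalso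
      rcases hmem q with hqA | hqB
      · have h1 := hA3 p hpA q hqA hpq
        have h2 := hA2 q hqA
        rw [Fin.lt_def] at h1
        omega
      · have h1 := hB3 p hpB q hqB hpq
        have h2 := hB2 q hqB
        rw [Fin.lt_def] at h1
        omega
    · have : q = p := by
        apply Fin.ext
        rw [Fin.le_def] at hpq
        have := p.2
        omega
      rw [this]; omega
  · intro i j h1 h2 hij
    refine hA3 i ((hmem i).resolve_right ?_) j ((hmem j).resolve_right ?_) hij
    · intro hh; have := hB2 i hh; omega
    · intro hh; have := hB2 j hh; omega
  · intro i j h1 h2 hij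
    refine hB3 i ((hmem i).resolve_left ?_) j ((hmem j).resolve_left ?_) hij
    · intro hh; have := hA2 i hh; omega
    · intro hh; have := hA2 j hh; omega

theorem minimal_crucial_structure (k l : ℕ) (hk : 2 ≤ k) (hl : 2 ≤ l) :
    (∀ (n : ℕ) (σ : Fin n → Fin n), Function.Bijective σ →
      RightCrucial k l n σ → k + l - 3 ≤ n) ∧
    (∀ σ : Fin (k + l - 3) → Fin (k + l - 3), Function.Bijective σ →
      RightCrucial k l (k + l - 3) σ →
      (σ ⟨k + l - 4, by omega⟩ : ℕ) = k - 2 ∧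
      (∀ i j : Fin (k + l - 3), (σ i : ℕ) < k - 2 → (σ j : ℕ) < k - 2 →
        i < j → σ i < σ j) ∧
      (∀ i j : Fin (k + l - 3), k - 1 ≤ (σ i : ℕ) → k - 1 ≤ (σ j : ℕ) →
        i < j → σ j < σ i)) := by
  obtain ⟨a, rfl⟩ : ∃ a, k = a + 1 := ⟨k - 1, by omega⟩
  obtain ⟨b, rfl⟩ : ∃ b, l = b + 1 := ⟨l - 1, by omega⟩
  refine ⟨?_, ?_⟩
  · intro n σ hσ h
    obtain ⟨v, A, B, hv, hA, hB, hA2, hB2, -, -⟩ :=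
      crucial_core (by omega) (by omega) σ h
    have hi := inter_card σ hσ.1 v A B hA2 hB2
    have hu := Finset.card_union_add_card_inter A B
    have hun : (A ∪ B).card ≤ n := by simpa using Finset.card_le_univ (A ∪ B)
    omega
  · intro σ hσ h
    obtain ⟨h1, h2, h3⟩ := minimal_aux (by omega) (by omega) (by omega) σ hσ.1 h
    refine ⟨?_, ?_, ?_⟩
    · rw [h1 _ (by simp only []; omega)]
      omega
    · intro i j hi hj hij
      exact h2 i j (by omega) (by omega) hij
    · intro i j hi hj hij
      exact h3 i j (by omega) (by omega) hij
end

section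
/- Let k, ℓ ≥ 2 and let σ = σ₁⋯σₙ be a (k,ℓ)-crucial permutation of length n. Let I ⊆ {1,…,n} be a set of k+ℓ−3 positions consisting of the positions of an occurrence of i_{k−1} ending at position n and the positions of an occurrence of d_{ℓ−1} ending at position n (sharing only position n). Then for every position i ∉ I, the permutation of length n−1 obtained by deleting σ_i from σ and taking the reduced form is again (k,ℓ)-crucial. -/
/-- Delete the element at position `i` from `σ` and take the reduced form:
position `j` of the result corresponds to position `i.succAbove j` of `σ`,
and values larger than the deleted value `σ i` are decreased by one. -/
def delRed {m : ℕ} (σ : Fin (m + 1) → Fin (m + 1)) (i : Fin (m + 1)) : Fin m → Fin m :=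
  fun j =>
    if h : (σ (i.succAbove j) : ℕ) < (σ i : ℕ) then
      ⟨(σ (i.succAbove j) : ℕ), by have h1 := (σ i).isLt; have h2 := j.isLt; omega⟩
    else
      ⟨(σ (i.succAbove j) : ℕ) - 1, by
        have h1 := (σ (i.succAbove j)).isLt; have h2 := j.isLt; omega⟩

theorem delRed_lt_iff {m : ℕ} (σ : Fin (m + 1) → Fin (m + 1)) (hσ : Function.Injective σ)
    (i : Fin (m + 1)) (a b : Fin m) :
    delRed σ i a < delRed σ i b ↔ σ (i.succAbove a) < σ (i.succAbove b) := by
  have ha : (σ (i.succAbove a) : ℕ) ≠ (σ i : ℕ) := fun h =>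
    Fin.succAbove_ne i a (hσ (Fin.ext h))
  have hb : (σ (i.succAbove b) : ℕ) ≠ (σ i : ℕ) := fun h =>
    Fin.succAbove_ne i b (hσ (Fin.ext h))
  unfold delRed
  split_ifs <;> simp only [Fin.lt_def] <;> omega

theorem delRed_inj {m : ℕ} (σ : Fin (m + 1) → Fin (m + 1)) (hσ : Function.Injective σ)
    (i : Fin (m + 1)) : Function.Injective (delRed σ i) := by
  intro a b h
  have h1 := delRed_lt_iff σ hσ i a b
  have h2 := delRed_lt_iff σ hσ i b a
  rw [h] at h1 h2
  simp only [lt_self_iff_false, false_iff, not_lt] at h1 h2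
  exact Fin.succAbove_right_injective (hσ (le_antisymm h2 h1))

theorem exists_pos_set {m : ℕ} (A : Finset (Fin (m + 1))) (i : Fin (m + 1)) (hi : i ∉ A) :
    ∃ T : Finset (Fin (m + 1)), T.card = A.card + 1 ∧
      ∀ x ∈ T, x = Fin.last m ∨ ∃ j : Fin m, x = j.castSucc ∧ i.succAbove j ∈ A := by
  classical
  let A' : Finset (Fin m) := Finset.univ.filter (fun j => i.succAbove j ∈ A)
  have hmap : A'.map i.succAboveEmb = A := by
    ext x
    simp only [Finset.mem_map, A', Finset.mem_filter, Finset.mem_univ, true_and,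
      Fin.coe_succAboveEmb]
    constructor
    · rintro ⟨j, hj, rfl⟩
      exact hj
    · intro hx
      obtain ⟨j, rfl⟩ := Fin.exists_succAbove_eq (x := x) (y := i) (fun h => hi (h ▸ hx))
      exact ⟨j, hx, rfl⟩
  refine ⟨insert (Fin.last m) (A'.map Fin.castSuccEmb), ?_, ?_⟩
  · rw [Finset.card_insert_of_notMem, Finset.card_map, ← hmap, Finset.card_map]
    simp only [Finset.mem_map, Fin.coe_castSuccEmb, not_exists, not_and]
    intro j _ h
    exact (Fin.castSucc_lt_last j).ne h
  · intro x hx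
    rcases Finset.mem_insert.1 hx with h | h
    · exact Or.inl h
    · obtain ⟨j, hj, rfl⟩ := Finset.mem_map.1 h
      exact Or.inr ⟨j, rfl, (Finset.mem_filter.1 hj).2⟩

/-- Lemma 3 of the paper: let `σ` be a `(k,l)`-crucial permutation of length
`m+1`, and let `A` (resp. `B`) be the set of positions of an occurrence of `i_{k-1}`
(resp. `d_{l-1}`) ending at the last position, sharing only the last position
(so `I = A ∪ B` consists of `k+l-3` positions). Then deleting any element at a position
`i ∉ A ∪ B` and taking the reduced form yields a `(k,l)`-crucial permutation of length `m`. -/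
theorem delete_nonessential_keeps_crucial (k l m : ℕ) (hk : 2 ≤ k) (hl : 2 ≤ l)
    (σ : Fin (m + 1) → Fin (m + 1)) (hσ : Function.Bijective σ)
    (hc : RightCrucial k l (m + 1) σ)
    (A B : Finset (Fin (m + 1)))
    (hA : A.card = k - 1) (hB : B.card = l - 1)
    (hAmono : StrictMonoOn σ ↑A) (hBanti : StrictAntiOn σ ↑B)
    (hAlast : Fin.last m ∈ A) (hBlast : Fin.last m ∈ B)
    (hAB : A ∩ B = {Fin.last m})
    (i : Fin (m + 1)) (hi : i ∉ A ∪ B) :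
    Function.Bijective (delRed σ i) ∧ RightCrucial k l m (delRed σ i) := by
  have hinj := hσ.1
  have hlt := delRed_lt_iff σ hinj i
  have hτ := delRed_inj σ hinj i
  have hiA : i ∉ A := fun h => hi (Finset.mem_union_left _ h)
  have hiB : i ∉ B := fun h => hi (Finset.mem_union_right _ h)
  obtain ⟨j0, hj0⟩ := Fin.exists_succAbove_eq (x := Fin.last m) (y := i)
    (fun h => hiA (h ▸ hAlast))
  have hmono : StrictMono i.succAbove := Fin.strictMono_succAbove i
  refine ⟨Finite.injective_iff_bijective.1 hτ, ⟨?_, ?_⟩, ?_⟩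
  · rintro ⟨f, hf, hg⟩
    exact hc.1.1 ⟨fun x => i.succAbove (f x), fun a b h => hmono (hf h),
      fun a b h => (hlt _ _).1 (hg h)⟩
  · rintro ⟨f, hf, hg⟩
    exact hc.1.2 ⟨fun x => i.succAbove (f x), fun a b h => hmono (hf h),
      fun a b h => (hlt _ _).1 (hg h)⟩
  · intro v
    rcases lt_or_ge (delRed σ i j0).castSucc v with hv | hv
    · left
      obtain ⟨T, hT, hmem⟩ := exists_pos_set A i hiA
      have hT2 : T.card = k := by omega
      refine ⟨T.orderEmbOfFin hT2, (T.orderEmbOfFin hT2).strictMono, ?_⟩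
      intro a b hab
      have hab' := (T.orderEmbOfFin hT2).strictMono hab
      have ha := hmem _ (T.orderEmbOfFin_mem hT2 a)
      have hb := hmem _ (T.orderEmbOfFin_mem hT2 b)
      simp only [Function.comp]
      generalize T.orderEmbOfFin hT2 a = x at *
      generalize T.orderEmbOfFin hT2 b = y at *
      rcases ha with rfl | ⟨ja, rfl, hja⟩
      · exact absurd hab' (not_lt.2 (Fin.le_last y))
      rcases hb with rfl | ⟨jb, rfl, hjb⟩
      · simp only [rightExt, Fin.snoc_castSucc, Fin.snoc_last]
        rw [Fin.succAbove_lt_iff_castSucc_lt]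
        refine lt_of_le_of_lt ?_ hv
        rw [Fin.castSucc_le_castSucc_iff, ← not_lt, hlt, not_lt, hj0]
        exact hAmono.monotoneOn hja hAlast (Fin.le_last _)
      · simp only [rightExt, Fin.snoc_castSucc]
        apply Fin.strictMono_succAbove v
        rw [hlt]
        exact hAmono hja hjb (hmono hab')
    · right
      obtain ⟨T, hT, hmem⟩ := exists_pos_set B i hiB
      have hT2 : T.card = l := by omega
      refine ⟨T.orderEmbOfFin hT2, (T.orderEmbOfFin hT2).strictMono, ?_⟩
      intro a b hab
      have hab' := (T.orderEmbOfFin hT2).strictMono hab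
      have ha := hmem _ (T.orderEmbOfFin_mem hT2 a)
      have hb := hmem _ (T.orderEmbOfFin_mem hT2 b)
      simp only [Function.comp]
      generalize T.orderEmbOfFin hT2 a = x at *
      generalize T.orderEmbOfFin hT2 b = y at *
      rcases ha with rfl | ⟨ja, rfl, hja⟩
      · exact absurd hab' (not_lt.2 (Fin.le_last y))
      rcases hb with rfl | ⟨jb, rfl, hjb⟩
      · simp only [rightExt, Fin.snoc_castSucc, Fin.snoc_last]
        rw [Fin.lt_succAbove_iff_le_castSucc]
        refine le_trans hv ?_
        rw [Fin.castSucc_le_castSucc_iff, ← not_lt, hlt, not_lt, hj0]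
        exact hBanti.antitoneOn hja hBlast (Fin.le_last _)
      · simp only [rightExt, Fin.snoc_castSucc]
        apply Fin.strictMono_succAbove v
        rw [hlt]
        exact hBanti hja hjb (hmono hab')
end

section
/- Let k, ℓ ≥ 3. For every n with k+ℓ−3 ≤ n ≤ (k−1)(ℓ−1), there exists a (k,ℓ)-crucial permutation of length n. -/
theorem aux_perm {n : ℕ} (g : Fin n → ℕ) (hg : Function.Injective g) :
    ∃ σ : Equiv.Perm (Fin n), ∀ i j, σ i < σ j ↔ g i < g j := by
  have hc : (Finset.univ.image g).card = n := by
    rw [Finset.card_image_of_injective _ hg]; simp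
  let e := (Finset.univ.image g).orderIsoOfFin hc
  let s : Fin n → Fin n := fun i => e.symm ⟨g i, by simp⟩
  have hs : ∀ i j, s i < s j ↔ g i < g j := by
    intro i j
    simp only [s, OrderIso.lt_iff_lt, Subtype.mk_lt_mk]
  have hinj : Function.Injective s := by
    intro i j h
    apply hg
    have := e.symm.injective h
    simpa using this
  refine ⟨Equiv.ofBijective s (Finite.injective_iff_bijective.1 hinj), ?_⟩
  intro i j
  exact hs i j

theorem aux_incr_s4 {n k : ℕ} (σ : Fin n → Fin n) (i : Fin (n + 1)) (u : Fin k → Fin n)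
    (hu : StrictMono u) (hs : StrictMono (σ ∘ u)) (hi : ∀ j, (σ (u j)).castSucc < i) :
    HasIncr (k + 1) (n + 1) (rightExt σ i) := by
  refine ⟨Fin.snoc (fun j => (u j).castSucc) (Fin.last n), ?_, ?_⟩
  · intro x y hxy
    induction y using Fin.lastCases with
    | last =>
      induction x using Fin.lastCases with
      | last => exact absurd hxy (lt_irrefl _)
      | cast x => simp [Fin.castSucc_lt_last]
    | cast y =>
      induction x using Fin.lastCases with
      | last => exact absurd hxy (not_lt.2 (Fin.le_last _))
      | cast x => simpa using hu (by simpa using hxy)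
  · intro x y hxy
    induction y using Fin.lastCases with
    | last =>
      induction x using Fin.lastCases with
      | last => exact absurd hxy (lt_irrefl _)
      | cast x =>
        simp only [rightExt, Function.comp, Fin.snoc_castSucc, Fin.snoc_last]
        rw [Fin.succAbove_of_castSucc_lt _ _ (hi x)]
        exact hi x
    | cast y =>
      induction x using Fin.lastCases with
      | last => exact absurd hxy (not_lt.2 (Fin.le_last _))
      | cast x =>
        simp only [rightExt, Function.comp, Fin.snoc_castSucc]
        exact Fin.strictMono_succAbove i (hs (by simpa using hxy))

theorem aux_decr_s4 {n k : ℕ} (σ : Fin n → Fin n) (i : Fin (n + 1)) (u : Fin k → Fin n)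
    (hu : StrictMono u) (hs : StrictAnti (σ ∘ u)) (hi : ∀ j, i ≤ (σ (u j)).castSucc) :
    HasDecr (k + 1) (n + 1) (rightExt σ i) := by
  refine ⟨Fin.snoc (fun j => (u j).castSucc) (Fin.last n), ?_, ?_⟩
  · intro x y hxy
    induction y using Fin.lastCases with
    | last =>
      induction x using Fin.lastCases with
      | last => exact absurd hxy (lt_irrefl _)
      | cast x => simp [Fin.castSucc_lt_last]
    | cast y =>
      induction x using Fin.lastCases with
      | last => exact absurd hxy (not_lt.2 (Fin.le_last _))
      | cast x => simpa using hu (by simpa using hxy)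
  · intro x y hxy
    induction y using Fin.lastCases with
    | last =>
      induction x using Fin.lastCases with
      | last => exact absurd hxy (lt_irrefl _)
      | cast x =>
        simp only [rightExt, Function.comp, Fin.snoc_castSucc, Fin.snoc_last]
        rw [Fin.succAbove_of_le_castSucc _ _ (hi x)]
        exact lt_of_le_of_lt (hi x) Fin.castSucc_lt_succ
    | cast y =>
      induction x using Fin.lastCases with
      | last => exact absurd hxy (not_lt.2 (Fin.le_last _))
      | cast x =>
        simp only [rightExt, Function.comp, Fin.snoc_castSucc]
        exact Fin.strictMono_succAbove i (hs (by simpa using hxy))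

/-- value of the layered permutation at position `p`. -/
def layVal (b p : ℕ) : ℕ := (p / b) * b + (b - 1 - p % b)

theorem layVal_div {b p : ℕ} (hb : 0 < b) : layVal b p / b = p / b := by
  unfold layVal
  have h : b - 1 - p % b < b := by omega
  rw [mul_comm, Nat.mul_add_div hb, Nat.div_eq_of_lt h, add_zero]

theorem layVal_lt_of_div {b p q : ℕ} (hb : 0 < b) (h : p / b < q / b) :
    layVal b p < layVal b q := by
  by_contra hc
  have := Nat.div_le_div_right (c := b) (not_lt.1 hc)
  rw [layVal_div hb, layVal_div hb] at this
  omega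

theorem layVal_lt_of_mod {b p q : ℕ} (hb : 0 < b) (h : p / b = q / b) (h2 : p < q) :
    layVal b q < layVal b p := by
  have h3 := Nat.div_add_mod p b
  have h4 := Nat.div_add_mod q b
  have h5 := Nat.mod_lt q hb
  rw [h] at h3
  unfold layVal
  rw [h]
  omega

theorem layVal_inj {b : ℕ} (hb : 0 < b) : Function.Injective (layVal b) := by
  intro p q h
  have hd : p / b = q / b := by rw [← layVal_div hb, h, layVal_div hb]
  rcases lt_trichotomy p q with h1 | h1 | h1
  · have := layVal_lt_of_mod hb hd h1; omega
  · exact h1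
  · have := layVal_lt_of_mod hb hd.symm h1; omega

/-- for every `n` with `k+l-3 ≤ n ≤ (k-1)(l-1)` there exists a `(k,l)`-crucial
permutation of length `n`. -/
theorem exists_crucial_of_each_length (k l : ℕ) (hk : 3 ≤ k) (hl : 3 ≤ l)
    (n : ℕ) (h1 : k + l - 3 ≤ n) (h2 : n ≤ (k - 1) * (l - 1)) :
    ∃ σ : Equiv.Perm (Fin n), RightCrucial k l n ⇑σ := by
  obtain ⟨a, rfl⟩ : ∃ a, k = (a + 1) + 1 := ⟨k - 2, by omega⟩
  obtain ⟨b, rfl⟩ : ∃ b, l = b + 1 := ⟨l - 1, by omega⟩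
  have hb : 0 < b := by omega
  simp only [Nat.add_sub_cancel] at h2
  let H : Finset ℕ := (Finset.range a).image (fun q => b * q + (b - 1)) ∪
    (Finset.range b).image (fun r => b * a + r)
  have hH : H ⊆ Finset.range ((a + 1) * b) := by
    intro x hx
    simp only [H, Finset.mem_union, Finset.mem_image, Finset.mem_range] at hx ⊢
    rcases hx with ⟨q, hq, rfl⟩ | ⟨r, hr, rfl⟩
    · have : b * (q + 1) ≤ b * a := Nat.mul_le_mul_left _ hq
      have e : (a + 1) * b = b * a + b := by ring
      have e' : b * (q + 1) = b * q + b := by ring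
      omega
    · have e : (a + 1) * b = b * a + b := by ring
      omega
  have hHc : H.card ≤ n := by
    have c1 := Finset.card_union_le ((Finset.range a).image (fun q => b * q + (b - 1)))
      ((Finset.range b).image (fun r => b * a + r))
    have c2 := Finset.card_image_le (s := Finset.range a) (f := fun q => b * q + (b - 1))
    have c3 := Finset.card_image_le (s := Finset.range b) (f := fun r => b * a + r)
    rw [Finset.card_range] at c2 c3
    change H.card ≤ _ at c1
    omega
  obtain ⟨S, hHS, hS, hSc⟩ := Finset.exists_subsuperset_card_eq hH hHc (by simpa using h2)
  let e := S.orderEmbOfFin hSc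
  have he : ∀ x ∈ S, ∃ i, e i = x := by
    intro x hx
    have : x ∈ Set.range e := by
      rw [Finset.range_orderEmbOfFin]; exact hx
    exact this
  have heS : ∀ i, e i < b * (a + 1) := by
    intro i
    have := hS (S.orderEmbOfFin_mem hSc i)
    rw [mul_comm]
    exact Finset.mem_range.1 this
  obtain ⟨σ, hσ⟩ := aux_perm (fun i => layVal b (e i)) ((layVal_inj hb).comp e.injective)
  have hrow : ∀ q : Fin (a + 1), ∃ i, e i = b * q + (b - 1) := by
    intro q
    apply he
    apply hHS
    simp only [H, Finset.mem_union, Finset.mem_image, Finset.mem_range]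
    rcases Nat.lt_or_ge q a with h | h
    · exact Or.inl ⟨q, h, rfl⟩
    · have : (q : ℕ) = a := by omega
      exact Or.inr ⟨b - 1, by omega, by rw [this]⟩
  have hcol : ∀ r : Fin b, ∃ i, e i = b * a + r := by
    intro r
    apply he
    apply hHS
    simp only [H, Finset.mem_union, Finset.mem_image, Finset.mem_range]
    exact Or.inr ⟨r, r.2, rfl⟩
  choose u hu using hrow
  choose v hv using hcol
  have hdu : ∀ q, e (u q) / b = q := by
    intro q
    rw [hu, Nat.mul_add_div hb, Nat.div_eq_of_lt (by omega)]; rfl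
  have hdv : ∀ r, e (v r) / b = a := by
    intro r
    rw [hv, Nat.mul_add_div hb, Nat.div_eq_of_lt r.2]; rfl
  have um : StrictMono u := by
    intro x y hxy
    rw [← e.lt_iff_lt]
    by_contra hc
    have := Nat.div_le_div_right (c := b) (not_lt.1 hc)
    rw [hdu, hdu] at this
    exact absurd hxy (not_lt.2 this)
  have us : StrictMono (σ ∘ u) := by
    intro x y hxy
    refine (hσ _ _).2 (layVal_lt_of_div hb ?_)
    rw [hdu, hdu]; exact hxy
  have vm : StrictMono v := by
    intro x y hxy
    rw [← e.lt_iff_lt, hv, hv]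
    have : (x : ℕ) < y := hxy
    omega
  have vs : StrictAnti (σ ∘ v) := by
    intro x y hxy
    refine (hσ _ _).2 (layVal_lt_of_mod hb ?_ (e.lt_iff_lt.2 (vm hxy)))
    rw [hdv, hdv]
  have huv : u (Fin.last a) = v ⟨b - 1, by omega⟩ := by
    apply e.injective
    rw [hu, hv]; rfl
  refine ⟨σ, ⟨?_, ?_⟩, ?_⟩
  · rintro ⟨f, hf, hf2⟩
    have hm : StrictMono (fun i => e (f i) / b) := by
      intro x y hxy
      by_contra hc
      have h3 := e.lt_iff_lt.2 (hf hxy)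
      have h4 : e (f x) / b = e (f y) / b :=
        le_antisymm (Nat.div_le_div_right h3.le) (not_lt.1 hc)
      have h5 := layVal_lt_of_mod hb h4 h3
      have h6 := (hσ _ _).1 (hf2 hxy)
      exact absurd h5 (not_lt.2 h6.le)
    have := Fintype.card_le_of_injective
      (fun i => (⟨e (f i) / b, Nat.div_lt_of_lt_mul (heS _)⟩ : Fin (a + 1)))
      (fun x y h => hm.injective (Fin.mk.inj_iff.1 h))
    simp at this
  · rintro ⟨f, hf, hf2⟩
    have hm : ∀ x y, x < y → e (f x) / b = e (f y) / b := by
      intro x y hxy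
      have h3 := e.lt_iff_lt.2 (hf hxy)
      by_contra hc
      have h4 := lt_of_le_of_ne (Nat.div_le_div_right (c := b) h3.le) hc
      have h5 := layVal_lt_of_div hb h4
      have h6 := (hσ _ _).1 (hf2 hxy)
      exact absurd h5 (not_lt.2 h6.le)
    have := Fintype.card_le_of_injective
      (fun i => (⟨e (f i) % b, Nat.mod_lt _ hb⟩ : Fin b))
      (by
        intro x y h
        have h' : e (f x) % b = e (f y) % b := Fin.mk.inj_iff.1 h
        have hd : e (f x) / b = e (f y) / b := by
          rcases lt_trichotomy x y with h | h | h
          · exact hm _ _ h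
          · rw [h]
          · exact (hm _ _ h).symm
        have h3 : e (f x) = e (f y) := by
          rw [← Nat.div_add_mod (e (f x)) b, hd, h', Nat.div_add_mod]
        exact hf.injective (e.injective h3))
    simp at this
  · intro i
    rcases lt_or_ge (σ (u (Fin.last a))).castSucc i with h | h
    · left
      refine aux_incr_s4 σ i u um us fun j => lt_of_le_of_lt ?_ h
      exact Fin.castSucc_le_castSucc_iff.2 (us.monotone (Fin.le_last j))
    · right
      refine aux_decr_s4 σ i v vm vs fun j => le_trans h ?_
      rw [huv]
      refine Fin.castSucc_le_castSucc_iff.2 (vs.antitone ?_)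
      change (j : ℕ) ≤ b - 1
      omega
end

section
/- Let k ≥ 3 and let s^(c)_n(k,3) denote the number of (k,3)-right-crucial permutations of length n. Then s^(c)_k(k,3) = k−1, and for every n with k+1 ≤ n ≤ 2(k−1), s^(c)_n(k,3) = ((2k−n)(2k−n−1)/((n−k)(n−k+1))) · C(n−1, k) · C(n, k), where C(a,b) denotes a binomial coefficient. -/
namespace K3

/-! ### Ballot numbers -/

def bal : ℕ → ℕ → ℕ
  | _, 0 => 1
  | 0, _ + 1 => 0
  | a + 1, b + 1 => if b ≤ a then bal a (b + 1) + bal (a + 1) b else 0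

theorem bal_zero (a : ℕ) : bal a 0 = 1 := by
  cases a <;> simp [bal]

theorem bal_gt (a b : ℕ) (h : a < b) : bal a b = 0 := by
  cases b with
  | zero => omega
  | succ b =>
    cases a with
    | zero => simp [bal]
    | succ a =>
      rw [bal, if_neg (by omega)]

theorem bal_rec (a b : ℕ) (h : b ≤ a) :
    bal (a + 1) (b + 1) = bal a (b + 1) + bal (a + 1) b := by
  rw [bal, if_pos h]

theorem bal_choose (a b : ℕ) (h : b ≤ a + 1) :
    bal a b + Nat.choose (a + b) (a + 1) = Nat.choose (a + b) a := by
  induction a generalizing b with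
  | zero =>
    interval_cases b <;> simp [bal]
  | succ a iha =>
    induction b with
    | zero => simp [bal_zero]
    | succ b ihb =>
      rcases Nat.lt_or_ge a b with h' | h'
      · have : b = a + 1 := by omega
        subst this
        rw [bal_gt _ _ (by omega), zero_add]
        rw [← Nat.choose_symm_of_eq_add]
        omega
      · rw [bal_rec a b h']
        have h1 := iha (b + 1) (by omega)
        have h2 := ihb (by omega)
        rw [show a + (b + 1) = a + b + 1 by ring] at h1
        rw [show a + 1 + b = a + b + 1 by ring] at h2
        rw [show a + 1 + (b + 1) = (a + b + 1) + 1 by ring]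
        rw [Nat.choose_succ_succ' (a + b + 1) (a + 1), Nat.choose_succ_succ' (a + b + 1) a]
        omega

theorem bal_mul (a b : ℕ) (h : b ≤ a + 1) :
    bal a b * b = (a + 1 - b) * Nat.choose (a + b) (a + 1) := by
  have h1 := bal_choose a b h
  have h2 := Nat.choose_succ_right_eq (a + b) a
  rw [show a + b - a = b by omega] at h2
  obtain ⟨c, hc⟩ := Nat.exists_eq_add_of_le h
  rw [show a + 1 - b = c by omega]
  rw [← h1] at h2
  rw [hc] at h2
  rw [← hc] at h2
  nlinarith [congrArg (· * Nat.choose (a + b) (a + 1)) hc]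

/-! ### Patterns with value bounds -/

def IncB (k v n : ℕ) (σ : Fin n → Fin n) : Prop :=
  ∃ f : Fin k → Fin n, StrictMono f ∧ StrictMono (σ ∘ f) ∧ ∀ j, (σ (f j) : ℕ) < v

def DecA (l v n : ℕ) (σ : Fin n → Fin n) : Prop :=
  ∃ f : Fin l → Fin n, StrictMono f ∧ StrictAnti (σ ∘ f) ∧ ∀ j, v ≤ (σ (f j) : ℕ)

theorem hasIncr_iff (k n : ℕ) (σ : Fin n → Fin n) : HasIncr k n σ ↔ IncB k n n σ := by
  constructor
  · rintro ⟨f, h1, h2⟩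
    exact ⟨f, h1, h2, fun j => (σ (f j)).2⟩
  · rintro ⟨f, h1, h2, _⟩
    exact ⟨f, h1, h2⟩

theorem hasDecr_iff (k n : ℕ) (σ : Fin n → Fin n) : HasDecr k n σ ↔ DecA k 0 n σ := by
  constructor
  · rintro ⟨f, h1, h2⟩
    exact ⟨f, h1, h2, fun j => Nat.zero_le _⟩
  · rintro ⟨f, h1, h2, _⟩
    exact ⟨f, h1, h2⟩

theorem incB_zero (v n : ℕ) (σ : Fin n → Fin n) : IncB 0 v n σ :=
  ⟨Fin.elim0, fun a => a.elim0, fun a => a.elim0, fun a => a.elim0⟩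

theorem decA_zero (v n : ℕ) (σ : Fin n → Fin n) : DecA 0 v n σ :=
  ⟨Fin.elim0, fun a => a.elim0, fun a => a.elim0, fun a => a.elim0⟩

theorem succAbove_val {n : ℕ} (i : Fin (n + 1)) (x : Fin n) :
    ((i.succAbove x : Fin (n + 1)) : ℕ) = if (x : ℕ) < i then (x : ℕ) else x + 1 := by
  unfold Fin.succAbove
  simp only [Fin.lt_def, Fin.val_castSucc]
  split_ifs <;> simp

theorem ext_cast {n : ℕ} (σ : Fin n → Fin n) (i : Fin (n + 1)) (j : Fin n) :
    rightExt σ i j.castSucc = i.succAbove (σ j) := by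
  simp [rightExt]

theorem ext_last {n : ℕ} (σ : Fin n → Fin n) (i : Fin (n + 1)) :
    rightExt σ i (Fin.last n) = i := by
  simp [rightExt]

/-- a strictly monotone map into `Fin (n+1)` either misses the last element or hits it exactly
at the end -/
theorem mono_cases {n k : ℕ} (f : Fin (k + 1) → Fin (n + 1)) (hf : StrictMono f) :
    (∃ g : Fin (k + 1) → Fin n, StrictMono g ∧ ∀ j, f j = (g j).castSucc) ∨
    (∃ g : Fin k → Fin n, StrictMono g ∧ (∀ j : Fin k, f j.castSucc = (g j).castSucc) ∧
      f (Fin.last k) = Fin.last n) := by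
  by_cases h : f (Fin.last k) = Fin.last n
  · right
    have hlt : ∀ j : Fin k, f j.castSucc ≠ Fin.last n := by
      intro j hj
      have := hf (Fin.castSucc_lt_last j)
      rw [hj, h] at this
      exact lt_irrefl _ this
    refine ⟨fun j => (f j.castSucc).castPred (hlt j), ?_, ?_, h⟩
    · intro a b hab
      exact Fin.castPred_lt_castPred (hf (Fin.castSucc_lt_castSucc_iff.2 hab)) (hlt b)
    · intro j
      simp
  · left
    have hlt : ∀ j : Fin (k + 1), f j ≠ Fin.last n := by
      intro j hj
      have h1 := hf.monotone (Fin.le_last j)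
      rw [hj] at h1
      exact h (le_antisymm (Fin.le_last _) h1)
    refine ⟨fun j => (f j).castPred (hlt j), ?_, ?_⟩
    · intro a b hab
      exact Fin.castPred_lt_castPred (hf hab) (hlt b)
    · intro j
      simp

theorem snoc_mono {n k : ℕ} (g : Fin k → Fin n) (hg : StrictMono g) :
    StrictMono (Fin.snoc (fun j => (g j).castSucc) (Fin.last n) : Fin (k + 1) → Fin (n + 1)) := by
  intro a b hab
  induction b using Fin.lastCases with
  | last =>
    induction a using Fin.lastCases with
    | last => exact absurd hab (lt_irrefl _)
    | cast a => simp [Fin.castSucc_lt_last]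
  | cast b =>
    induction a using Fin.lastCases with
    | last => exact absurd (hab.trans (Fin.castSucc_lt_last b)) (lt_irrefl _)
    | cast a =>
      simp only [Fin.snoc_castSucc, Fin.castSucc_lt_castSucc_iff]
      exact hg (Fin.castSucc_lt_castSucc_iff.1 hab)

theorem incB_ext (k v n : ℕ) (σ : Fin n → Fin n) (i : Fin (n + 1)) :
    IncB (k + 1) v (n + 1) (rightExt σ i) ↔
      IncB (k + 1) (if v ≤ i then v else v - 1) n σ ∨ ((i : ℕ) < v ∧ IncB k i n σ) := by
  constructor
  · rintro ⟨f, h1, h2, h3⟩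
    rcases mono_cases f h1 with ⟨g, hg, hfg⟩ | ⟨g, hg, hfg, hl⟩
    · left
      refine ⟨g, hg, ?_, ?_⟩
      · intro a b hab
        have := h2 hab
        simp only [Function.comp, hfg, ext_cast] at this
        exact (Fin.strictMono_succAbove i).lt_iff_lt.1 this
      · intro j
        have := h3 j
        rw [hfg, ext_cast, succAbove_val] at this
        split_ifs at * <;> omega
    · right
      refine ⟨?_, g, hg, ?_, ?_⟩
      · have := h3 (Fin.last k)
        rwa [hl, ext_last] at this
      · intro a b hab
        have := h2 (Fin.castSucc_lt_castSucc_iff.2 hab)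
        simp only [Function.comp, hfg, ext_cast] at this
        exact (Fin.strictMono_succAbove i).lt_iff_lt.1 this
      · intro j
        have := h2 (Fin.castSucc_lt_last j)
        simp only [Function.comp, hfg, hl, ext_cast, ext_last] at this
        rw [Fin.lt_def, succAbove_val] at this
        split_ifs at * <;> omega
  · rintro (⟨g, h1, h2, h3⟩ | ⟨hv, g, h1, h2, h3⟩)
    · refine ⟨fun j => (g j).castSucc, ?_, ?_, ?_⟩
      · intro a b hab
        exact Fin.castSucc_lt_castSucc_iff.2 (h1 hab)
      · intro a b hab
        simp only [Function.comp, ext_cast]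
        exact Fin.strictMono_succAbove i (h2 hab)
      · intro j
        have := h3 j
        rw [ext_cast, succAbove_val]
        split_ifs at * <;> omega
    · refine ⟨_, snoc_mono g h1, ?_, ?_⟩
      · intro a b hab
        induction b using Fin.lastCases with
        | last =>
          induction a using Fin.lastCases with
          | last => exact absurd hab (lt_irrefl _)
          | cast a =>
            simp only [Function.comp, Fin.snoc_castSucc, Fin.snoc_last, ext_cast, ext_last]
            rw [Fin.lt_def, succAbove_val, if_pos (h3 a)]
            exact h3 a
        | cast b =>
          induction a using Fin.lastCases with
          | last => exact absurd (hab.trans (Fin.castSucc_lt_last b)) (lt_irrefl _)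
          | cast a =>
            simp only [Function.comp, Fin.snoc_castSucc, ext_cast]
            exact Fin.strictMono_succAbove i (h2 (Fin.castSucc_lt_castSucc_iff.1 hab))
      · intro j
        induction j using Fin.lastCases with
        | last => simpa only [Fin.snoc_last, ext_last] using hv
        | cast j =>
          simp only [Fin.snoc_castSucc, ext_cast]
          rw [succAbove_val, if_pos (h3 j)]
          exact (h3 j).trans hv

theorem decA_ext (k v n : ℕ) (σ : Fin n → Fin n) (i : Fin (n + 1)) :
    DecA (k + 1) v (n + 1) (rightExt σ i) ↔
      DecA (k + 1) (if v ≤ i then v else v - 1) n σ ∨ (v ≤ (i : ℕ) ∧ DecA k i n σ) := by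
  constructor
  · rintro ⟨f, h1, h2, h3⟩
    rcases mono_cases f h1 with ⟨g, hg, hfg⟩ | ⟨g, hg, hfg, hl⟩
    · left
      refine ⟨g, hg, ?_, ?_⟩
      · intro a b hab
        have := h2 hab
        simp only [Function.comp, hfg, ext_cast] at this
        exact (Fin.strictMono_succAbove i).lt_iff_lt.1 this
      · intro j
        have := h3 j
        rw [hfg, ext_cast, succAbove_val] at this
        split_ifs at * <;> omega
    · right
      refine ⟨?_, g, hg, ?_, ?_⟩
      · have := h3 (Fin.last k)
        rwa [hl, ext_last] at this
      · intro a b hab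
        have := h2 (Fin.castSucc_lt_castSucc_iff.2 hab)
        simp only [Function.comp, hfg, ext_cast] at this
        exact (Fin.strictMono_succAbove i).lt_iff_lt.1 this
      · intro j
        have := h2 (Fin.castSucc_lt_last j)
        simp only [Function.comp, hfg, hl, ext_cast, ext_last] at this
        rw [Fin.lt_def, succAbove_val] at this
        split_ifs at * <;> omega
  · rintro (⟨g, h1, h2, h3⟩ | ⟨hv, g, h1, h2, h3⟩)
    · refine ⟨fun j => (g j).castSucc, ?_, ?_, ?_⟩
      · intro a b hab
        exact Fin.castSucc_lt_castSucc_iff.2 (h1 hab)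
      · intro a b hab
        simp only [Function.comp, ext_cast]
        exact Fin.strictMono_succAbove i (h2 hab)
      · intro j
        have := h3 j
        rw [ext_cast, succAbove_val]
        split_ifs at * <;> omega
    · refine ⟨_, snoc_mono g h1, ?_, ?_⟩
      · intro a b hab
        induction b using Fin.lastCases with
        | last =>
          induction a using Fin.lastCases with
          | last => exact absurd hab (lt_irrefl _)
          | cast a =>
            simp only [Function.comp, Fin.snoc_castSucc, Fin.snoc_last, ext_cast, ext_last]
            have := h3 a
            rw [Fin.lt_def, succAbove_val, if_neg (by omega)]
            omega
        | cast b =>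
          induction a using Fin.lastCases with
          | last => exact absurd (hab.trans (Fin.castSucc_lt_last b)) (lt_irrefl _)
          | cast a =>
            simp only [Function.comp, Fin.snoc_castSucc, ext_cast]
            exact Fin.strictMono_succAbove i (h2 (Fin.castSucc_lt_castSucc_iff.1 hab))
      · intro j
        induction j using Fin.lastCases with
        | last => simpa only [Fin.snoc_last, ext_last] using hv
        | cast j =>
          simp only [Fin.snoc_castSucc, ext_cast]
          have := h3 j
          rw [succAbove_val, if_neg (by omega)]
          omega

/-! ### Decomposing permutations -/

def extPerm {n : ℕ} (p : Fin (n + 1) × Equiv.Perm (Fin n)) : Equiv.Perm (Fin (n + 1)) :=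
  ((finSuccEquiv' (Fin.last n)).trans (Equiv.optionCongr p.2)).trans (finSuccEquiv' p.1).symm

theorem extPerm_coe {n : ℕ} (p : Fin (n + 1) × Equiv.Perm (Fin n)) :
    ⇑(extPerm p) = rightExt ⇑p.2 p.1 := by
  funext j
  induction j using Fin.lastCases with
  | last => simp [extPerm, ext_last]
  | cast j =>
    rw [ext_cast]
    simp [extPerm, finSuccEquiv'_last_apply_castSucc]

theorem extPerm_inj {n : ℕ} : Function.Injective (@extPerm n) := by
  rintro ⟨i, σ⟩ ⟨i', σ'⟩ h
  have h1 := congrArg (fun e : Equiv.Perm (Fin (n + 1)) => (e : Fin (n + 1) → Fin (n + 1))) h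
  simp only [extPerm_coe] at h1
  have h2 := congrFun h1 (Fin.last n)
  rw [ext_last, ext_last] at h2
  subst h2
  congr 1
  ext j
  have h3 := congrFun h1 j.castSucc
  rw [ext_cast, ext_cast] at h3
  rw [Fin.succAbove_right_injective h3]

theorem extPerm_bij (n : ℕ) : Function.Bijective (@extPerm n) := by
  rw [Fintype.bijective_iff_injective_and_card]
  refine ⟨extPerm_inj, ?_⟩
  simp [Fintype.card_perm, Nat.factorial_succ]

noncomputable def decomp (n : ℕ) :
    Fin (n + 1) × Equiv.Perm (Fin n) ≃ Equiv.Perm (Fin (n + 1)) :=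
  Equiv.ofBijective extPerm (extPerm_bij n)

theorem decomp_coe {n : ℕ} (p : Fin (n + 1) × Equiv.Perm (Fin n)) :
    ⇑(decomp n p) = rightExt ⇑p.2 p.1 := extPerm_coe p

/-! ### The state machine -/

structure St where
  a : ℕ
  r : ℕ
  t : ℕ

def step (n i : ℕ) (s : St) : Option St :=
  if i < n - s.r - s.t then none
  else if i = n then some ⟨s.a + 1, s.r, s.t + 1⟩
  else if s.t = 0 then some ⟨s.a + 1, n - i, 0⟩
  else if i ≤ n - s.t then some ⟨s.a, n - s.t - i + 1, s.t - 1⟩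
  else some ⟨s.a, 1, n - i - 1⟩

noncomputable def state : (n : ℕ) → Equiv.Perm (Fin n) → Option St
  | 0, _ => some ⟨0, 0, 0⟩
  | n + 1, σ => (state n ((decomp n).symm σ).2).bind (step n ((decomp n).symm σ).1)

theorem state_decomp (n : ℕ) (p : Fin (n + 1) × Equiv.Perm (Fin n)) :
    state (n + 1) (decomp n p) = (state n p.2).bind (step n p.1) := by
  simp [state]

theorem decA_one (n : ℕ) (σ : Equiv.Perm (Fin n)) (v : ℕ) : DecA 1 v n σ ↔ v < n := by
  constructor
  · rintro ⟨f, _, _, h⟩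
    exact lt_of_le_of_lt (h 0) (σ (f 0)).2
  · intro h
    refine ⟨fun _ => σ.symm ⟨v, h⟩, Subsingleton.strictMono _, ?_, ?_⟩
    · intro a b hab
      exact absurd (Subsingleton.elim a b) hab.ne
    · intro j
      simp

def Spec (n : ℕ) (σ : Fin n → Fin n) (s : St) : Prop :=
  s.r + s.t ≤ n ∧ s.a ≤ n ∧ s.t ≤ s.a ∧ ¬ DecA 3 0 n σ ∧
  (∀ v, DecA 2 v n σ ↔ v < n - s.r - s.t) ∧
  ∀ v, n - s.r - s.t ≤ v → v ≤ n → ∀ j, IncB j v n σ ↔ j ≤ s.a - s.t + (v - (n - s.t))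

theorem spec_step (n : ℕ) (σ : Equiv.Perm (Fin n)) (i : Fin (n + 1)) (s s' : St)
    (hs : Spec n σ s) (h : step n i s = some s') : Spec (n + 1) (rightExt σ i) s' := by
  obtain ⟨h1, h2, h3, h4, h5, h6⟩ := hs
  obtain ⟨a, r, t⟩ := s
  obtain ⟨a', r', t'⟩ := s'
  have hi : (i : ℕ) ≤ n := Nat.lt_succ_iff.1 i.2
  obtain ⟨i0, hi0⟩ : ∃ i0 : ℕ, i0 = (i : ℕ) := ⟨_, rfl⟩
  rw [← hi0] at h hi
  simp only [step] at h
  simp only at h1 h2 h3 h5 h6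
  have hm : n - r - t ≤ i0 := by
    by_contra hc
    rw [if_pos (by omega)] at h
    cases h
  rw [if_neg (by omega)] at h
  have hD3 : ¬ DecA 3 0 (n + 1) (rightExt σ i) := by
    rw [decA_ext, if_pos (Nat.zero_le _)]
    rintro (hc | ⟨_, hc⟩)
    · exact h4 hc
    · rw [h5, ← hi0] at hc
      omega
  have hD2 : ∀ v, DecA 2 v (n + 1) (rightExt σ i) ↔
      ((if v ≤ i0 then v else v - 1) < n - r - t ∨ (v ≤ i0 ∧ i0 < n)) := by
    intro v
    rw [decA_ext, decA_one, h5, ← hi0]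
  have hI : ∀ v j, n - r - t ≤ v → v ≤ n + 1 →
      (IncB (j + 1) v (n + 1) (rightExt σ i) ↔
      (j + 1 ≤ a - t + ((if v ≤ i0 then v else v - 1) - (n - t)) ∨
        (i0 < v ∧ j ≤ a - t + (i0 - (n - t))))) := by
    intro v j hv1 hv2
    rw [incB_ext, ← hi0, h6 i0 hm hi, h6]
    · split_ifs <;> omega
    · split_ifs <;> omega
  clear h4 h5 h6
  have key : (r' + t' ≤ n + 1 ∧ a' ≤ n + 1 ∧ t' ≤ a' ∧ n - r - t ≤ n + 1 - r' - t') ∧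
      (∀ v, ((if v ≤ i0 then v else v - 1) < n - r - t ∨ (v ≤ i0 ∧ i0 < n)) ↔
        v < n + 1 - r' - t') ∧
      ∀ v, n + 1 - r' - t' ≤ v → v ≤ n + 1 → ∀ j,
        ((j + 1 ≤ a - t + ((if v ≤ i0 then v else v - 1) - (n - t)) ∨
        (i0 < v ∧ j ≤ a - t + (i0 - (n - t)))) ↔
        j + 1 ≤ a' - t' + (v - (n + 1 - t'))) := by
    split_ifs at h <;> simp only [Option.some.injEq, St.mk.injEq] at h <;>
      obtain ⟨rfl, rfl, rfl⟩ := h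
    all_goals
      refine ⟨by omega, ?_, ?_⟩
      · intro v
        split_ifs <;> omega
      · intro v hv1 hv2 j
        split_ifs <;> omega
  obtain ⟨⟨k1, k2, k3, k4⟩, k5, k6⟩ := key
  refine ⟨k1, k2, k3, hD3, fun v => (hD2 v).trans (k5 v), ?_⟩
  intro v hv1 hv2 j
  simp only at hv1 ⊢
  cases j with
  | zero => simp [incB_zero]
  | succ j =>
    rw [hI v j (by omega) hv2]
    exact k6 v hv1 hv2 j

theorem spec_state (n : ℕ) (σ : Equiv.Perm (Fin n)) :
    (state n σ = none ∧ DecA 3 0 n σ) ∨ ∃ s, state n σ = some s ∧ Spec n σ s := by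
  induction n with
  | zero =>
    right
    refine ⟨_, rfl, le_rfl, le_rfl, le_rfl, ?_, ?_, ?_⟩
    · rintro ⟨f, _⟩
      exact (f 0).elim0
    · intro v
      simp only [Nat.zero_sub, Nat.not_lt_zero, iff_false]
      rintro ⟨f, _⟩
      exact (f 0).elim0
    · intro v _ hv j
      have : v = 0 := by omega
      subst this
      constructor
      · rintro ⟨f, _⟩
        by_contra hc
        exact (f ⟨0, by omega⟩).elim0
      · intro hj
        have : j = 0 := by simpa using hj
        subst this
        exact incB_zero _ _ _
  | succ n ih =>
    obtain ⟨⟨i, τ⟩, rfl⟩ := (decomp n).surjective σ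
    rw [state_decomp, decomp_coe]
    rcases ih τ with ⟨h1, h2⟩ | ⟨s, h1, h2⟩
    · left
      refine ⟨by simp [h1], ?_⟩
      rw [decA_ext, if_pos (Nat.zero_le _)]
      exact Or.inl h2
    · rw [h1]
      simp only [Option.bind_some]
      cases h : step n i s with
      | none =>
        left
        refine ⟨rfl, ?_⟩
        rw [decA_ext, if_pos (Nat.zero_le _)]
        refine Or.inr ⟨Nat.zero_le _, ?_⟩
        rw [h2.2.2.2.2.1]
        by_contra hc
        unfold step at h
        rw [if_neg hc] at h
        split_ifs at h
      | some s' =>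
        right
        exact ⟨s', rfl, spec_step n τ i s s' h2 h⟩

theorem crucial_iff (k n : ℕ) (hk : 1 ≤ k) (σ : Equiv.Perm (Fin n)) :
    RightCrucial k 3 n σ ↔ ∃ s, state n σ = some s ∧ s.a + 1 = k ∧ s.t = 0 := by
  obtain ⟨k, rfl⟩ : ∃ k', k = k' + 1 := ⟨k - 1, by omega⟩
  unfold RightCrucial AvoidsPat ContainsPat
  simp only [hasIncr_iff, hasDecr_iff]
  rcases spec_state n σ with ⟨h1, h2⟩ | ⟨s, h1, h2⟩
  · constructor
    · intro h
      exact absurd h2 h.1.2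
    · rintro ⟨s, hs, _⟩
      rw [h1] at hs
      cases hs
  · obtain ⟨g1, g2, g3, g4, g5, g6⟩ := h2
    have hn := g6 n (by omega) le_rfl
    constructor
    · rintro ⟨⟨h3, _⟩, h4⟩
      refine ⟨s, h1, ?_⟩
      rw [hn] at h3
      have := h4 ⟨n - s.r - s.t, by omega⟩
      rw [incB_ext, decA_ext, if_neg (by simp; omega), if_pos (Nat.zero_le _), g5] at this
      simp only [Nat.add_sub_cancel, lt_irrefl, and_false, or_false, g4] at this
      rw [hn, g6 _ le_rfl (by omega)] at this
      omega
    · rintro ⟨s', h3, h4, h5⟩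
      rw [h1] at h3
      cases h3
      refine ⟨⟨?_, g4⟩, ?_⟩
      · rw [hn]
        omega
      · intro i
        have hi : (i : ℕ) ≤ n := Nat.lt_succ_iff.1 i.2
        rw [incB_ext, decA_ext, if_neg (by omega), if_pos (Nat.zero_le _), g5]
        by_cases hc : (i : ℕ) < n - s.r - s.t
        · exact Or.inr (Or.inr ⟨Nat.zero_le _, hc⟩)
        · refine Or.inl (Or.inr ⟨by omega, ?_⟩)
          rw [g6 _ (by omega) hi]
          omega

/-! ### Counting -/

open Classical in
noncomputable def cnt (n : ℕ) (P : St → Prop) : ℕ :=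
  (Finset.univ.filter fun σ : Equiv.Perm (Fin n) => ∃ s, state n σ = some s ∧ P s).card

theorem cnt_congr (n : ℕ) (P Q : St → Prop)
    (h : ∀ s : St, s.r + s.t ≤ n → s.a ≤ n → (P s ↔ Q s)) : cnt n P = cnt n Q := by
  classical
  unfold cnt
  congr 1
  ext σ
  simp only [Finset.mem_filter, Finset.mem_univ, true_and]
  refine exists_congr fun s => and_congr_right fun hs => ?_
  rcases spec_state n σ with ⟨h1, _⟩ | ⟨s', h1, h2⟩
  · rw [h1] at hs
    cases hs
  · rw [h1] at hs
    cases hs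
    exact h s h2.1 h2.2.1

theorem cnt_false (n : ℕ) (P : St → Prop)
    (h : ∀ s : St, s.r + s.t ≤ n → s.a ≤ n → ¬ P s) : cnt n P = 0 := by
  classical
  rw [cnt_congr n P (fun _ => False) (fun s h1 h2 => by simp [h s h1 h2])]
  simp [cnt]

theorem cnt_or (n : ℕ) (P Q : St → Prop) (h : ∀ s, P s → Q s → False) :
    cnt n (fun s => P s ∨ Q s) = cnt n P + cnt n Q := by
  classical
  unfold cnt
  rw [← Finset.card_union_of_disjoint]
  · congr 1
    ext σ
    simp only [Finset.mem_filter, Finset.mem_univ, true_and, Finset.mem_union]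
    constructor
    · rintro ⟨s, hs, h1 | h1⟩
      · exact Or.inl ⟨s, hs, h1⟩
      · exact Or.inr ⟨s, hs, h1⟩
    · rintro (⟨s, hs, h1⟩ | ⟨s, hs, h1⟩)
      · exact ⟨s, hs, Or.inl h1⟩
      · exact ⟨s, hs, Or.inr h1⟩
  · rw [Finset.disjoint_filter]
    rintro σ _ ⟨s, hs, h1⟩ ⟨s', hs', h2⟩
    rw [hs] at hs'
    cases hs'
    exact h s h1 h2

theorem cnt_succ (n : ℕ) (P : St → Prop) :
    cnt (n + 1) P = ∑ i : Fin (n + 1), cnt n (fun s => ∃ s', step n i s = some s' ∧ P s') := by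
  classical
  unfold cnt
  rw [← Finset.card_sigma]
  symm
  refine Finset.card_bij (fun x _ => decomp n (x.1, x.2)) ?_ ?_ ?_
  · rintro ⟨i, σ⟩ hx
    simp only [Finset.mem_sigma, Finset.mem_filter, Finset.mem_univ, true_and] at hx ⊢
    obtain ⟨s, hs, s', hs', hP⟩ := hx
    refine ⟨s', ?_, hP⟩
    rw [state_decomp]
    simp [hs, hs']
  · rintro ⟨i, σ⟩ _ ⟨i', σ'⟩ _ h
    have := (decomp n).injective h
    simp only [Prod.mk.injEq] at this
    obtain ⟨rfl, rfl⟩ := this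
    rfl
  · intro τ hτ
    obtain ⟨⟨i, σ⟩, rfl⟩ := (decomp n).surjective τ
    simp only [Finset.mem_filter, Finset.mem_univ, true_and] at hτ
    obtain ⟨s', hs', hP⟩ := hτ
    rw [state_decomp] at hs'
    obtain ⟨s, h1, h2⟩ := Option.bind_eq_some_iff.1 hs'
    refine ⟨⟨i, σ⟩, ?_, rfl⟩
    simp only [Finset.mem_sigma, Finset.mem_filter, Finset.mem_univ, true_and]
    exact ⟨s, h1, s', h2, hP⟩

def Z (a τ ρ : ℕ) (s : St) : Prop := s.a = a ∧ s.t = τ ∧ s.r = ρ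

def X (a τ ρ : ℕ) (s : St) : Prop :=
  s.a = a ∧ ((ρ = 0 ∧ τ ≤ s.t) ∨ (1 ≤ ρ ∧ s.t = τ ∧ ρ ≤ s.r))

theorem step_Z (n i a τ ρ : ℕ) (s : St) (h1 : s.r + s.t ≤ n) (hi : i ≤ n) :
    (∃ s', step n i s = some s' ∧ Z a τ ρ s') ↔
      ((i = n ∧ 1 ≤ τ ∧ s.a + 1 = a ∧ s.t + 1 = τ ∧ s.r = ρ) ∨
       (i + ρ + τ = n ∧ 1 ≤ ρ ∧
        ((τ = 0 ∧ 1 ≤ a ∧ X (a - 1) 0 ρ s) ∨ X a (τ + 1) (ρ - 1) s))) := by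
  obtain ⟨a0, r, t⟩ := s
  simp only at h1
  have : (∃ s', step n i ⟨a0, r, t⟩ = some s' ∧ Z a τ ρ s') ↔
      step n i ⟨a0, r, t⟩ = some ⟨a, ρ, τ⟩ := by
    constructor
    · rintro ⟨⟨x, y, z⟩, h, rfl, rfl, rfl⟩
      exact h
    · intro h
      exact ⟨_, h, rfl, rfl, rfl⟩
  rw [this]
  unfold step X
  simp only
  split_ifs <;> simp only [Option.some.injEq, St.mk.injEq, false_iff] <;> omega

theorem cnt_Z_succ (n a τ ρ : ℕ) :
    cnt (n + 1) (Z a τ ρ) =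
      cnt n (fun s => 1 ≤ τ ∧ s.a + 1 = a ∧ s.t + 1 = τ ∧ s.r = ρ) +
      cnt n (fun s => 1 ≤ ρ ∧
        ((τ = 0 ∧ 1 ≤ a ∧ X (a - 1) 0 ρ s) ∨ X a (τ + 1) (ρ - 1) s)) := by
  rw [cnt_succ]
  have h : ∀ i : Fin (n + 1), cnt n (fun s => ∃ s', step n i s = some s' ∧ Z a τ ρ s') =
      (if i = Fin.last n then
        cnt n (fun s => 1 ≤ τ ∧ s.a + 1 = a ∧ s.t + 1 = τ ∧ s.r = ρ) else 0) +
      (if (i : ℕ) + ρ + τ = n then cnt n (fun s => 1 ≤ ρ ∧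
        ((τ = 0 ∧ 1 ≤ a ∧ X (a - 1) 0 ρ s) ∨ X a (τ + 1) (ρ - 1) s)) else 0) := by
    intro i
    have hi : (i : ℕ) ≤ n := Nat.lt_succ_iff.1 i.2
    rw [cnt_congr n _ _ (fun s h1 _ => step_Z n i a τ ρ s h1 hi)]
    rw [cnt_or]
    · congr 1
      · split_ifs with hc
        · subst hc
          simp
        · refine cnt_false n _ ?_
          rintro s _ _ ⟨h, _⟩
          exact hc (Fin.ext h)
      · split_ifs with hc
        · simp [hc]
        · refine cnt_false n _ ?_
          rintro s _ _ ⟨h, _⟩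
          exact hc h
    · rintro s ⟨h1, _⟩ ⟨h2, h3, _⟩
      omega
  rw [Finset.sum_congr rfl (fun i _ => h i), Finset.sum_add_distrib]
  congr 1
  · simp
  · by_cases hc : ρ + τ ≤ n
    · rw [Finset.sum_eq_single (⟨n - ρ - τ, by omega⟩ : Fin (n + 1))]
      · rw [if_pos]
        simp only
        omega
      · intro i _ hne
        rw [if_neg]
        intro h
        apply hne
        apply Fin.ext
        simp only
        omega
      · simp
    · rw [Finset.sum_eq_zero]
      · symm
        refine cnt_false n _ ?_
        rintro ⟨a0, r, t⟩ h1 _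
        unfold X
        simp only at h1 ⊢
        omega
      · intro i _
        rw [if_neg]
        omega

/-- the all-ones states -/
theorem cnt_Z_zero (n a τ : ℕ) :
    cnt n (Z a τ 0) = if a = n ∧ τ = n then 1 else 0 := by
  classical
  induction n generalizing a τ with
  | zero =>
    by_cases h : a = 0 ∧ τ = 0
    · obtain ⟨rfl, rfl⟩ := h
      simp [cnt, state, Z]
    · rw [if_neg h]
      refine cnt_false _ _ ?_
      rintro ⟨a0, r, t⟩ h1 h2 ⟨rfl, rfl, h3⟩
      simp only at *
      omega
  | succ n ih =>
    rw [cnt_Z_succ]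
    rw [cnt_false n (fun s => 1 ≤ 0 ∧ _) (by intro s _ _; omega), add_zero]
    by_cases h : 1 ≤ a ∧ 1 ≤ τ
    · rw [cnt_congr n _ (Z (a - 1) (τ - 1) 0), ih]
      · split_ifs <;> omega
      · intro s _ _
        unfold Z
        omega
    · rw [cnt_false, if_neg]
      · omega
      · intro s _ _
        omega

theorem cnt_X_pos (n a τ ρ : ℕ) (h : 1 ≤ ρ) :
    cnt n (X a τ ρ) = cnt n (Z a τ ρ) + cnt n (X a τ (ρ + 1)) := by
  rw [← cnt_or]
  · refine cnt_congr n _ _ ?_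
    intro s _ _
    unfold X Z
    omega
  · intro s
    unfold X Z
    omega

theorem cnt_X_zero (n a τ : ℕ) :
    cnt n (X a τ 0) = cnt n (Z a τ 0) + (cnt n (X a τ 1) + cnt n (X a (τ + 1) 0)) := by
  rw [← cnt_or, ← cnt_or]
  · refine cnt_congr n _ _ ?_
    intro s _ _
    unfold X Z
    omega
  · intro s
    unfold X Z
    omega
  · intro s
    unfold X
    omega

def zf (a b τ ρ : ℕ) : ℕ := if b + τ ≤ a ∧ ρ ≤ b then bal a b * bal (a - τ - 1) (b - ρ) else 0

def xf (a b τ ρ : ℕ) : ℕ := if b + τ ≤ a ∧ ρ ≤ b then bal a b * bal (a - τ) (b - ρ) else 0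

theorem bal_rec' (a b : ℕ) (h1 : 1 ≤ b) (h : b ≤ a) :
    bal a b = bal (a - 1) b + bal a (b - 1) := by
  obtain ⟨b, rfl⟩ : ∃ c, b = c + 1 := ⟨b - 1, by omega⟩
  obtain ⟨a, rfl⟩ : ∃ c, a = c + 1 := ⟨a - 1, by omega⟩
  exact bal_rec a b (by omega)

theorem xf_rec (a b τ ρ : ℕ) (h : 1 ≤ ρ) : xf a b τ ρ = zf a b τ ρ + xf a b τ (ρ + 1) := by
  unfold xf zf
  by_cases h1 : b + τ ≤ a ∧ ρ ≤ b
  · rw [if_pos h1, if_pos h1]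
    by_cases h2 : ρ = b
    · subst h2
      simp [bal_zero]
    · rw [if_pos (by omega), bal_rec' (a - τ) (b - ρ) (by omega) (by omega)]
      rw [show b - (ρ + 1) = b - ρ - 1 by omega]
      ring
  · rw [if_neg h1, if_neg h1, if_neg (by omega)]

theorem xf_rec0 (a b τ : ℕ) :
    xf a b τ 0 = (if a = a + b ∧ τ = a + b then 1 else 0) + (xf a b τ 1 + xf a b (τ + 1) 0) := by
  unfold xf
  by_cases h1 : b + τ ≤ a
  · rw [if_pos (by omega)]
    rcases Nat.eq_zero_or_pos b with hb | hb
    · subst hb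
      simp only [Nat.sub_zero, bal_zero]
      split_ifs <;> omega
    · rw [if_neg (by omega), if_pos (by omega : b + τ ≤ a ∧ 1 ≤ b)]
      simp only [Nat.sub_zero]
      rw [bal_rec' (a - τ) b (by omega) (by omega)]
      by_cases h2 : b + τ = a
      · rw [if_neg (by omega), bal_gt (a - τ - 1) b (by omega)]
        ring
      · rw [if_pos (by omega), show a - (τ + 1) = a - τ - 1 by omega]
        ring
  · rw [if_neg (by omega), if_neg (by omega), if_neg (by omega), if_neg (by omega)]

theorem X_of_Z (n : ℕ) (hZ : ∀ a b τ ρ, a + b = n → 1 ≤ ρ → cnt n (Z a τ ρ) = zf a b τ ρ) :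
    ∀ a b τ ρ, a + b = n → cnt n (X a τ ρ) = xf a b τ ρ := by
  have hpos : ∀ d a b τ ρ, a + b = n → 1 ≤ ρ → n + 1 ≤ ρ + d →
      cnt n (X a τ ρ) = xf a b τ ρ := by
    intro d
    induction d with
    | zero =>
      intro a b τ ρ hab h1 h2
      rw [cnt_false]
      · unfold xf
        rw [if_neg (by omega)]
      · intro s _ _
        unfold X
        omega
    | succ d ih =>
      intro a b τ ρ hab h1 h2
      rw [cnt_X_pos n a τ ρ h1, hZ a b τ ρ hab h1, ih a b τ (ρ + 1) hab (by omega) (by omega),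
        xf_rec a b τ ρ h1]
  have hzero : ∀ d a b τ, a + b = n → n + 1 ≤ τ + d → cnt n (X a τ 0) = xf a b τ 0 := by
    intro d
    induction d with
    | zero =>
      intro a b τ hab h2
      rw [cnt_false]
      · unfold xf
        rw [if_neg (by omega)]
      · intro s _ _
        unfold X
        omega
    | succ d ih =>
      intro a b τ hab h2
      rw [cnt_X_zero, cnt_Z_zero, ih a b (τ + 1) hab (by omega),
        hpos (n + 1) a b τ 1 hab le_rfl (by omega), xf_rec0 a b τ, hab]
  intro a b τ ρ hab
  rcases Nat.eq_zero_or_pos ρ with h | h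
  · subst h
    exact hzero (n + 1) a b τ hab (by omega)
  · exact hpos (n + 1) a b τ ρ hab h (by omega)

theorem Z_formula (n : ℕ) :
    ∀ a b τ ρ, a + b = n → 1 ≤ ρ → cnt n (Z a τ ρ) = zf a b τ ρ := by
  induction n with
  | zero =>
    intro a b τ ρ hab hρ
    rw [cnt_false]
    · unfold zf
      rw [if_neg (by omega)]
    · intro s _ _
      unfold Z
      omega
  | succ n ihZ =>
    have ihX := X_of_Z n ihZ
    intro a b τ ρ hab hρ
    rw [cnt_Z_succ]
    rcases Nat.eq_zero_or_pos b with hb | hb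
    · subst hb
      unfold zf
      rw [if_neg (by omega)]
      have e1 : cnt n (fun s => 1 ≤ τ ∧ s.a + 1 = a ∧ s.t + 1 = τ ∧ s.r = ρ) = 0 := by
        by_cases hτ : 1 ≤ τ
        · rw [cnt_congr n _ (Z (a - 1) (τ - 1) ρ), ihZ (a - 1) 0 _ _ (by omega) hρ]
          · unfold zf
            rw [if_neg (by omega)]
          · intro s _ _
            unfold Z
            omega
        · refine cnt_false n _ ?_
          intro s _ _
          omega
      have e2 : cnt n (fun s => 1 ≤ ρ ∧
          ((τ = 0 ∧ 1 ≤ a ∧ X (a - 1) 0 ρ s) ∨ X a (τ + 1) (ρ - 1) s)) = 0 := by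
        by_cases hτ : τ = 0
        · rw [cnt_congr n _ (X (a - 1) 0 ρ), ihX (a - 1) 0 _ _ (by omega)]
          · unfold xf
            rw [if_neg (by omega)]
          · intro s _ _
            unfold X
            omega
        · refine cnt_false n _ ?_
          intro s _ _
          unfold X
          omega
      rw [e1, e2]
    · have hX2 := ihX a (b - 1) (τ + 1) (ρ - 1) (by omega)
      rcases Nat.eq_zero_or_pos a with ha | ha
      · subst ha
        unfold zf
        rw [if_neg (by omega)]
        rw [cnt_false, cnt_congr n _ (X 0 (τ + 1) (ρ - 1)), hX2]
        · unfold xf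
          rw [if_neg (by omega)]
        · intro s _ _
          unfold X
          omega
        · intro s _ _
          omega
      · have main : cnt n (fun s => 1 ≤ τ ∧ s.a + 1 = a ∧ s.t + 1 = τ ∧ s.r = ρ) +
            cnt n (fun s => 1 ≤ ρ ∧
            ((τ = 0 ∧ 1 ≤ a ∧ X (a - 1) 0 ρ s) ∨ X a (τ + 1) (ρ - 1) s)) =
            (if b + τ ≤ a ∧ ρ ≤ b then bal (a - 1) b * bal (a - τ - 1) (b - ρ) else 0) +
            cnt n (X a (τ + 1) (ρ - 1)) := by
          rcases Nat.eq_zero_or_pos τ with hτ | hτ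
          · subst hτ
            rw [cnt_false n (fun s => 1 ≤ 0 ∧ _) (by intro s _ _; omega), zero_add]
            rw [cnt_congr n _ (fun s => X (a - 1) 0 ρ s ∨ X a (0 + 1) (ρ - 1) s), cnt_or]
            · congr 1
              rw [ihX (a - 1) b 0 ρ (by omega)]
              unfold xf
              by_cases h1 : b ≤ a - 1
              · simp only [Nat.sub_zero]
                split_ifs <;> omega
              · rw [if_neg (by omega), bal_gt (a - 1) b (by omega)]
                simp
            · intro s
              unfold X
              omega
            · intro s _ _
              simp [hρ, Nat.one_le_iff_ne_zero.2 ha.ne', Nat.succ_le_of_lt ha]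
          · congr 1
            · rw [cnt_congr n _ (Z (a - 1) (τ - 1) ρ), ihZ (a - 1) b (τ - 1) ρ (by omega) hρ]
              · unfold zf
                rw [show a - 1 - (τ - 1) - 1 = a - τ - 1 by omega]
                split_ifs <;> omega
              · intro s _ _
                unfold Z
                omega
            · refine cnt_congr n _ _ ?_
              intro s _ _
              simp [hρ, hτ.ne']
        rw [main, hX2]
        unfold xf zf
        by_cases h1 : b + τ ≤ a ∧ ρ ≤ b
        · rw [if_pos h1, if_pos h1, if_pos (by omega), bal_rec' a b hb (by omega),
            show a - (τ + 1) = a - τ - 1 by omega, show b - 1 - (ρ - 1) = b - ρ by omega]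
          ring
        · rw [if_neg h1, if_neg h1, if_neg (by omega)]

theorem crucial_card (a b : ℕ) (hb : 1 ≤ b) (hab : b ≤ a) :
    Nat.card {σ : Equiv.Perm (Fin (a + b)) // RightCrucial (a + 1) 3 (a + b) ⇑σ} =
      bal a b * bal a (b - 1) := by
  classical
  have e : Nat.card {σ : Equiv.Perm (Fin (a + b)) // RightCrucial (a + 1) 3 (a + b) ⇑σ} =
      cnt (a + b) (fun s => s.a + 1 = a + 1 ∧ s.t = 0) := by
    rw [Nat.card_eq_fintype_card, Fintype.card_subtype]
    unfold cnt
    congr 1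
    ext σ
    simp only [Finset.mem_filter, Finset.mem_univ, true_and]
    exact crucial_iff (a + 1) (a + b) (by omega) σ
  rw [e, cnt_congr _ _ (fun s => Z a 0 0 s ∨ X a 0 1 s), cnt_or, cnt_Z_zero,
    X_of_Z (a + b) (Z_formula (a + b)) a b 0 1 rfl]
  · unfold xf
    rw [if_neg (by omega), if_pos (by omega)]
    simp
  · intro s
    unfold X Z
    omega
  · intro s _ _
    unfold X Z
    omega

end K3

/-- Corollary on `(k,3)`-crucial permutations: the number of `(k,3)`-right-crucial
permutations of length `k` is `k-1`, and for `k+1 ≤ n ≤ 2(k-1)` the number `s` of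
`(k,3)`-right-crucial permutations of length `n` satisfies
`s·(n-k)(n-k+1) = (2k-n)(2k-n-1)·C(n-1,k)·C(n,k)`
(i.e. `s = ((2k-n)(2k-n-1)/((n-k)(n-k+1)))·C(n-1,k)·C(n,k)`). -/
theorem count_k3_crucial (k : ℕ) (hk : 3 ≤ k) :
    Nat.card {σ : Equiv.Perm (Fin k) // RightCrucial k 3 k ⇑σ} = k - 1 ∧
    ∀ n : ℕ, k + 1 ≤ n → n ≤ 2 * (k - 1) →
      Nat.card {σ : Equiv.Perm (Fin n) // RightCrucial k 3 n ⇑σ} *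
          ((n - k) * (n - k + 1)) =
        (2 * k - n) * (2 * k - n - 1) * Nat.choose (n - 1) k * Nat.choose n k := by
  obtain ⟨a, rfl⟩ : ∃ a, k = a + 1 := ⟨k - 1, by omega⟩
  refine ⟨?_, ?_⟩
  · rw [K3.crucial_card a 1 le_rfl (by omega)]
    have := K3.bal_mul a 1 (by omega)
    simp [K3.bal_zero] at this ⊢
    exact this
  · intro n h1 h2
    obtain ⟨b, rfl⟩ : ∃ b, n = a + (b + 1) := ⟨n - a - 1, by omega⟩
    rw [K3.crucial_card a (b + 1) (by omega) (by omega)]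
    have e1 := K3.bal_mul a (b + 1) (by omega)
    have e2 := K3.bal_mul a b (by omega)
    rw [show a + (b + 1) - (a + 1) = b by omega,
      show 2 * (a + 1) - (a + (b + 1)) = a + 1 - b by omega,
      show a + 1 - b - 1 = a + 1 - (b + 1) by omega,
      show a + (b + 1) - 1 = a + b by omega, show b + 1 - 1 = b by omega]
    calc K3.bal a (b + 1) * K3.bal a b * (b * (b + 1))
        = (K3.bal a (b + 1) * (b + 1)) * (K3.bal a b * b) := by ring
      _ = _ := by
        rw [e1, e2]
        ring
end
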